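/- Let α ∈ (0,1) and 1 < p ≤ q < ∞ with 1/q + 1/p' = α, let 𝒮 be an η-sparse collection of dyadic cubes in ℝⁿ, and let ω be a weight on ℝⁿ with [ω]_{A_{pq}} < ∞. Then there is a constant C depending only on n, p, q, α, η such that for all f ∈ L^p_{ω^p}: ‖A^{2,α}_𝒮 f‖_{L^q_{ω^q}} ≤ C · [ω]_{A_{pq}}^{1/q} · ( [ω^{−p'}]_{A∞}^{1/q} + [ω^q]_{A∞}^{(1/2 − 1/p)_+} ) · ‖f‖_{L^p_{ω^p}}, where x_+ := max(x,0). -/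

import Mathlib

open MeasureTheory ENNReal Set

noncomputable section

/-- An axis-parallel (closed) cube in ℝⁿ with corner `corner` and side length `side > 0`. -/
structure Cube (n : ℕ) where
  corner : Fin n → ℝ
  side : ℝ
  side_pos : 0 < side

namespace Cube

/-- The set of points of the cube. -/
def carrier {n : ℕ} (Q : Cube n) : Set (Fin n → ℝ) :=
  {x | ∀ i, Q.corner i ≤ x i ∧ x i ≤ Q.corner i + Q.side}

/-- The volume `|Q|` of the cube. -/
def vol {n : ℕ} (Q : Cube n) : ℝ := Q.side ^ n

/-- `Q` is a cube of the standard dyadic grid: `Q = 2^{-j}([0,1]^n + m)`. -/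
def IsDyadic {n : ℕ} (Q : Cube n) : Prop :=
  ∃ (j : ℤ) (m : Fin n → ℤ),
    Q.side = (2 : ℝ) ^ (-j) ∧ ∀ i, Q.corner i = (m i : ℝ) * (2 : ℝ) ^ (-j)

end Cube

/-- `η`-sparseness of a collection of cubes: there are pairwise disjoint measurable
subsets `E Q ⊆ Q` with `|E Q| ≥ η |Q|`. -/
def IsSparse {n : ℕ} (η : ℝ) (S : Set (Cube n)) : Prop :=
  ∃ E : Cube n → Set (Fin n → ℝ),
    (∀ Q ∈ S, MeasurableSet (E Q)) ∧ (∀ Q ∈ S, E Q ⊆ Q.carrier) ∧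
    (S.Pairwise (fun Q Q' => Disjoint (E Q) (E Q'))) ∧
    (∀ Q ∈ S, ENNReal.ofReal (η * Q.vol) ≤ volume (E Q))

/-- A weight: a nonnegative locally integrable function on ℝⁿ. -/
def IsWeight {n : ℕ} (w : (Fin n → ℝ) → ℝ) : Prop :=
  MeasureTheory.LocallyIntegrable w volume ∧ ∀ x, 0 ≤ w x

/-- `ω(Q) = ∫_Q ω`. -/
def wMass {n : ℕ} (w : (Fin n → ℝ) → ℝ) (Q : Cube n) : ℝ≥0∞ :=
  ∫⁻ x in Q.carrier, ENNReal.ofReal (w x)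

/-- The weighted `L^s` (quasi)norm `‖f‖_{L^s_w} = (∫ |f|^s w)^{1/s}`, valued in `ℝ≥0∞`. -/
def wNorm {n : ℕ} (s : ℝ) (w f : (Fin n → ℝ) → ℝ) : ℝ≥0∞ :=
  (∫⁻ x, ENNReal.ofReal (|f x| ^ s) * ENNReal.ofReal (w x)) ^ (1 / s)

/-- The weighted `L^s` (quasi)norm of an `ℝ≥0∞`-valued function. -/
def eNorm {n : ℕ} (s : ℝ) (w : (Fin n → ℝ) → ℝ) (g : (Fin n → ℝ) → ℝ≥0∞) : ℝ≥0∞ :=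
  (∫⁻ x, g x ^ s * ENNReal.ofReal (w x)) ^ (1 / s)

/-- `Σ_{Q ∈ D} g(Q) 1_Q`. -/
def cubeSum {n : ℕ} (D : Set (Cube n)) (g : Cube n → ℝ≥0∞) (x : Fin n → ℝ) : ℝ≥0∞ :=
  ∑' Q : D, Q.1.carrier.indicator (fun _ => g Q.1) x

/-- The sparse operator `A^{r,α}_S f = (Σ_{Q∈S} (|Q|^{-α} ∫_Q f)^r 1_Q)^{1/r}`
(for nonnegative `f`; negative values are truncated). -/
def sparseOp {n : ℕ} (S : Set (Cube n)) (r α : ℝ) (f : (Fin n → ℝ) → ℝ)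
    (x : Fin n → ℝ) : ℝ≥0∞ :=
  (cubeSum S
      (fun Q => ((ENNReal.ofReal Q.vol) ^ (-α) * ∫⁻ y in Q.carrier, ENNReal.ofReal (f y)) ^ r)
      x) ^ (1 / r)

/-- The Hardy–Littlewood maximal function over axis-parallel cubes. -/
def maximal {n : ℕ} (w : (Fin n → ℝ) → ℝ) (x : Fin n → ℝ) : ℝ≥0∞ :=
  ⨆ (Q : Cube n) (_ : x ∈ Q.carrier),
    (ENNReal.ofReal Q.vol)⁻¹ * ∫⁻ y in Q.carrier, ENNReal.ofReal |w y|

/-- The Fujii–Wilson `A∞`-characteristic `[w]_{A∞} = sup_Q ω(Q)⁻¹ ∫_Q M(1_Q ω)`. -/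
def AinfChar {n : ℕ} (w : (Fin n → ℝ) → ℝ) : ℝ≥0∞ :=
  ⨆ Q : Cube n, (wMass w Q)⁻¹ * ∫⁻ x in Q.carrier, maximal (Q.carrier.indicator w) x

/-- The two-weight characteristic
`[ω,σ]_{A^α_{pq}(S)} = sup_{Q∈S} |Q|^{-α} ω(Q)^{1/q} σ(Q)^{1/p'}` (here `1/p' = 1 - 1/p`). -/
def twoWeightChar {n : ℕ} (p q α : ℝ) (S : Set (Cube n)) (w σ' : (Fin n → ℝ) → ℝ) : ℝ≥0∞ :=
  ⨆ Q ∈ S, (ENNReal.ofReal Q.vol) ^ (-α) * wMass w Q ^ (1 / q) * wMass σ' Q ^ (1 - 1 / p)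

/-- The one-weight characteristic
`[w]_{A_{pq}} = sup_Q (|Q|⁻¹ ∫_Q w^q)(|Q|⁻¹ ∫_Q w^{-p'})^{q/p'}`, `p' = p/(p-1)`. -/
def ApqChar {n : ℕ} (p q : ℝ) (w : (Fin n → ℝ) → ℝ) : ℝ≥0∞ :=
  ⨆ Q : Cube n,
    ((ENNReal.ofReal Q.vol)⁻¹ * ∫⁻ x in Q.carrier, (ENNReal.ofReal (w x)) ^ q) *
      ((ENNReal.ofReal Q.vol)⁻¹ *
          ∫⁻ x in Q.carrier, (ENNReal.ofReal (w x)) ^ (-(p / (p - 1)))) ^ (q / (p / (p - 1)))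

/-- The testing constant `𝒯`. -/
def testT {n : ℕ} (p q r α : ℝ) (S : Set (Cube n)) (w σ' : (Fin n → ℝ) → ℝ) : ℝ≥0∞ :=
  ⨆ R ∈ S,
    wMass σ' R ^ (-(r / p)) *
      eNorm (q / r) w
        (cubeSum {Q | Q ∈ S ∧ Q.carrier ⊆ R.carrier}
          (fun Q => (ENNReal.ofReal Q.vol) ^ (-(α * r)) * wMass σ' Q ^ r))

/-- The testing constant `𝒯*`; here `1/(q/r)' = 1 - r/q` and `(p/r)' = (p/r)/((p/r)-1)`. -/
def testTstar {n : ℕ} (p q r α : ℝ) (S : Set (Cube n)) (w σ' : (Fin n → ℝ) → ℝ) : ℝ≥0∞ :=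
  ⨆ R ∈ S,
    wMass w R ^ (-(1 - r / q)) *
      eNorm ((p / r) / (p / r - 1)) σ'
        (cubeSum {Q | Q ∈ S ∧ Q.carrier ⊆ R.carrier}
          (fun Q => (ENNReal.ofReal Q.vol) ^ (-(α * r)) * wMass σ' Q ^ (r - 1) * wMass w Q))

/-- The operator (quasi)norm of `A^{r,α}_S(·σ) : L^p_σ → L^q_ω`, i.e. the least constant `K`
with `‖A^{r,α}_S(fσ)‖_{L^q_ω} ≤ K ‖f‖_{L^p_σ}` for all `f`. -/
def sparseOpNorm {n : ℕ} (p q r α : ℝ) (S : Set (Cube n)) (w σ' : (Fin n → ℝ) → ℝ) : ℝ≥0∞ :=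
  sInf {K : ℝ≥0∞ | ∀ f : (Fin n → ℝ) → ℝ, Measurable f →
    eNorm q w (sparseOp S r α (fun y => f y * σ' y)) ≤ K * wNorm p σ' f}

/-! ### Elementary inequalities in `ℝ≥0∞` -/

/-- Hölder's inequality for finite sums in the form `∑ fᵃ gᵇ ≤ (∑ f)ᵃ (∑ g)ᵇ`, `a + b = 1`. -/
theorem sum_rpow_mul_rpow_le {ι : Type*} (s : Finset ι) (f g : ι → ℝ≥0∞) {a b : ℝ}
    (ha : 0 ≤ a) (hb : 0 ≤ b) (hab : a + b = 1) :
    ∑ i ∈ s, f i ^ a * g i ^ b ≤ (∑ i ∈ s, f i) ^ a * (∑ i ∈ s, g i) ^ b := by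
  rcases ha.eq_or_lt with rfl | ha'
  · obtain rfl : b = 1 := by linarith
    simp
  rcases hb.eq_or_lt with rfl | hb'
  · obtain rfl : a = 1 := by linarith
    simp
  have hc : (1 / a).HolderConjugate (1 / b) := by
    rw [Real.holderConjugate_iff]
    refine ⟨by rw [lt_div_iff₀ ha']; linarith, by simp [hab]⟩
  have h := ENNReal.inner_le_Lp_mul_Lq s (fun i => f i ^ a) (fun i => g i ^ b) hc
  simpa only [← ENNReal.rpow_mul, one_div_one_div, mul_one_div_cancel ha'.ne',
    mul_one_div_cancel hb'.ne', ENNReal.rpow_one] using h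

theorem sum_rpow_mul_rpow_mul_rpow_le {ι : Type*} (s : Finset ι) (f g h : ι → ℝ≥0∞) {a b c : ℝ}
    (ha : 0 ≤ a) (hb : 0 ≤ b) (hc : 0 ≤ c) (hbc : 0 < b + c) (habc : a + b + c = 1) :
    ∑ i ∈ s, f i ^ a * (g i ^ b * h i ^ c) ≤
      (∑ i ∈ s, f i) ^ a * ((∑ i ∈ s, g i) ^ b * (∑ i ∈ s, h i) ^ c) := by
  have key : ∀ x y : ℝ≥0∞, x ^ b * y ^ c = (x ^ (b / (b + c)) * y ^ (c / (b + c))) ^ (b + c) := by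
    intro x y
    rw [ENNReal.mul_rpow_of_nonneg _ _ hbc.le, ← ENNReal.rpow_mul, ← ENNReal.rpow_mul,
      div_mul_cancel₀ _ hbc.ne', div_mul_cancel₀ _ hbc.ne']
  simp_rw [key]
  refine (sum_rpow_mul_rpow_le s f _ ha hbc.le (by linarith)).trans ?_
  gcongr
  exact sum_rpow_mul_rpow_le s g h (by positivity) (by positivity) (by field_simp)

theorem real_rpow_add_sub_le {x y a b : ℝ} (hx : 0 ≤ x) (hy : 0 ≤ y) (ha : 0 < a) (hb : 0 < b) :
    x ^ (a + b) - y ^ (a + b) ≤ (a + b) / a * (x ^ b * (x ^ a - y ^ a)) := by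
  have hab : 0 < a + b := by positivity
  have h := Real.geom_mean_le_arith_mean2_weighted (w₁ := b / (a + b)) (w₂ := a / (a + b))
    (p₁ := x ^ (a + b)) (p₂ := y ^ (a + b)) (by positivity) (by positivity) (by positivity)
    (by positivity) (by field_simp; ring)
  rw [← Real.rpow_mul hx, ← Real.rpow_mul hy, mul_div_cancel₀ _ hab.ne',
    mul_div_cancel₀ _ hab.ne'] at h
  have hx' : x ^ (a + b) = x ^ b * x ^ a := by rw [← Real.rpow_add_of_nonneg hx hb.le ha.le, add_comm]
  have h2 : (a + b) * (x ^ b * y ^ a) ≤ b * x ^ (a + b) + a * y ^ (a + b) := by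
    have := mul_le_mul_of_nonneg_left h hab.le
    field_simp at this
    linarith
  rw [mul_sub, ← hx', div_mul_eq_mul_div, le_div_iff₀ ha]
  linarith

/-- For `y ≤ x`: `x ^ (a + b) - y ^ (a + b) ≤ (a + b) / a * x ^ b * (x ^ a - y ^ a)`. -/
theorem rpow_add_sub_rpow_le {x y : ℝ≥0∞} {a b : ℝ} (hyx : y ≤ x) (hx : x ≠ ∞)
    (ha : 0 < a) (hb : 0 < b) :
    x ^ (a + b) - y ^ (a + b) ≤ ENNReal.ofReal ((a + b) / a) * (x ^ b * (x ^ a - y ^ a)) := by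
  have hab : 0 < a + b := by positivity
  have hy : y ≠ ∞ := ne_top_of_le_ne_top hx hyx
  lift x to NNReal using hx
  lift y to NNReal using hy
  have key := real_rpow_add_sub_le x.coe_nonneg y.coe_nonneg ha hb
  have e : ∀ (z : NNReal) {c : ℝ}, 0 < c → (z : ℝ≥0∞) ^ c = ENNReal.ofReal ((z : ℝ) ^ c) := by
    intro z c hc
    rw [← ENNReal.ofReal_coe_nnreal, ENNReal.ofReal_rpow_of_nonneg z.coe_nonneg hc.le]
  rw [e x hab, e y hab, e x hb, e x ha, e y ha, ← ENNReal.ofReal_sub _ (by positivity),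
    ← ENNReal.ofReal_sub _ (by positivity), ← ENNReal.ofReal_mul (by positivity),
    ← ENNReal.ofReal_mul (by positivity)]
  exact ENNReal.ofReal_le_ofReal key

theorem rpow_tsub_rpow_le {x y : ℝ≥0∞} {a m : ℝ} (hm : 1 ≤ m) :
    (x ^ a - y ^ a) ^ m ≤ x ^ (a * m) - y ^ (a * m) := by
  rcases le_total (y ^ a) (x ^ a) with h | h
  · by_cases hy : y ^ (a * m) = ∞
    · have : y ^ a = ∞ := by
        rw [ENNReal.rpow_mul] at hy
        exact ((ENNReal.rpow_eq_top_iff_of_pos (by linarith)).1 hy)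
      rw [this, ENNReal.sub_top, ENNReal.zero_rpow_of_pos (by linarith)]
      exact zero_le
    · apply ENNReal.le_sub_of_add_le_right hy
      rw [ENNReal.rpow_mul, ENNReal.rpow_mul]
      calc _ ≤ (x ^ a - y ^ a + y ^ a) ^ m := ENNReal.add_rpow_le_rpow_add _ _ hm
        _ = _ := by rw [tsub_add_cancel_of_le h]
  · rw [tsub_eq_zero_of_le h, ENNReal.zero_rpow_of_pos (by linarith)]
    exact zero_le

/-! ### Laminar families -/

/-- A finite family of nonempty sets any two of which are nested or disjoint. -/
structure Laminar {ι X : Type*} (F : Finset ι) (K : ι → Set X) : Prop where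
  nested : ∀ Q ∈ F, ∀ R ∈ F, K Q ⊆ K R ∨ K R ⊆ K Q ∨ Disjoint (K Q) (K R)
  inj : Set.InjOn K F
  nonempty : ∀ Q ∈ F, (K Q).Nonempty

/-- The members of the family that contain the set `A`. -/
def above {ι X : Type*} (F : Finset ι) (K : ι → Set X) (A : Set X) : Finset ι :=
  open Classical in F.filter (fun R => A ⊆ K R)

/-- The members of the family that contain `K R`, except `R` itself. -/
def strictAbove {ι X : Type*} (F : Finset ι) (K : ι → Set X) (R : ι) : Finset ι :=
  open Classical in (above F K (K R)).erase R

/-- The increment at `R` of a functional along the chain of ancestors of `R`. -/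
def incr {ι X : Type*} (F : Finset ι) (K : ι → Set X) (Φ : Finset ι → ℝ≥0∞) (R : ι) : ℝ≥0∞ :=
  Φ (above F K (K R)) - Φ (strictAbove F K R)

section Laminar

variable {ι X : Type*} {F : Finset ι} {K : ι → Set X}

theorem mem_above {A : Set X} {R : ι} : R ∈ above F K A ↔ R ∈ F ∧ A ⊆ K R := by
  simp [above]

theorem self_mem_above {R : ι} (hR : R ∈ F) : R ∈ above F K (K R) :=
  mem_above.2 ⟨hR, Subset.rfl⟩

theorem mem_above_singleton {x : X} {R : ι} : R ∈ above F K {x} ↔ R ∈ F ∧ x ∈ K R := by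
  simp [above]

theorem above_anti {A B : Set X} (h : A ⊆ B) : above F K B ⊆ above F K A := fun _ hR =>
  mem_above.2 ⟨(mem_above.1 hR).1, h.trans (mem_above.1 hR).2⟩

theorem strictAbove_subset (R : ι) : strictAbove F K R ⊆ above F K (K R) := by
  classical exact Finset.erase_subset _ _

theorem Laminar.mono (h : Laminar F K) {G : Finset ι} (hG : G ⊆ F) : Laminar G K :=
  ⟨fun Q hQ R hR => h.nested Q (hG hQ) R (hG hR), h.inj.mono (by exact_mod_cast hG),
    fun Q hQ => h.nonempty Q (hG hQ)⟩

/-- An upward closed chain of a laminar family is telescoped by the increments. -/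
theorem Laminar.sum_incr_chain (h : Laminar F K) {Φ : Finset ι → ℝ≥0∞} (hΦ : Monotone Φ)
    (h0 : Φ ∅ = 0) (c : Finset ι) (hcF : c ⊆ F) (hup : ∀ R ∈ c, above F K (K R) ⊆ c)
    (hch : ∀ Q ∈ c, ∀ R ∈ c, K Q ⊆ K R ∨ K R ⊆ K Q) :
    ∑ R ∈ c, incr F K Φ R = Φ c := by
  classical
  induction c using Finset.strongInduction with
  | H c ih =>
    rcases c.eq_empty_or_nonempty with rfl | hne
    · simp [h0]
    obtain ⟨m, hm, hmin⟩ := Finset.exists_minimalFor K c hne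
    have hle : ∀ R ∈ c, K m ⊆ K R := fun R hR =>
      (hch m hm R hR).elim id (fun hRm => hmin hR hRm)
    have hcm : above F K (K m) = c :=
      (hup m hm).antisymm fun R hR => mem_above.2 ⟨hcF hR, hle R hR⟩
    have hs : strictAbove F K m = c.erase m := by rw [strictAbove, hcm]
    rw [← Finset.add_sum_erase _ _ hm, ih (c.erase m) (Finset.erase_ssubset hm)
      ((Finset.erase_subset _ _).trans hcF), incr, hcm, hs,
      tsub_add_cancel_of_le (hΦ (Finset.erase_subset _ _))]
    · intro R hR T hT
      rw [Finset.mem_erase] at hR ⊢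
      refine ⟨?_, hup R hR.2 hT⟩
      rintro rfl
      exact hR.1 (h.inj (hcF hR.2) (hcF hm) ((mem_above.1 hT).2.antisymm (hle R hR.2)))
    · intro Q hQ R hR
      exact hch Q (Finset.mem_of_mem_erase hQ) R (Finset.mem_of_mem_erase hR)

theorem Laminar.sum_incr (h : Laminar F K) {Φ : Finset ι → ℝ≥0∞} (hΦ : Monotone Φ)
    (h0 : Φ ∅ = 0) {A : Set X} (hA : A.Nonempty) :
    ∑ R ∈ above F K A, incr F K Φ R = Φ (above F K A) := by
  obtain ⟨x, hx⟩ := hA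
  refine h.sum_incr_chain hΦ h0 _ (fun R hR => (mem_above.1 hR).1)
    (fun R hR => above_anti (mem_above.1 hR).2) fun Q hQ R hR => ?_
  rw [mem_above] at hQ hR
  rcases h.nested Q hQ.1 R hR.1 with h1 | h1 | h1
  · exact Or.inl h1
  · exact Or.inr h1
  · exact absurd (hR.2 hx) (Set.disjoint_left.1 h1 (hQ.2 hx))

/-- Summation by parts: packing of `c` controls sums of `c` against functionals of the chain. -/
theorem Laminar.sum_mul_le (h : Laminar F K) {Φ : Finset ι → ℝ≥0∞} (hΦ : Monotone Φ)
    (h0 : Φ ∅ = 0) {c m : ι → ℝ≥0∞} {C : ℝ≥0∞}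
    (hpack : ∀ R ∈ F, (open Classical in ∑ Q ∈ F with K Q ⊆ K R, c Q) ≤ C * m R) :
    ∑ Q ∈ F, c Q * Φ (above F K (K Q)) ≤ C * ∑ R ∈ F, incr F K Φ R * m R := by
  classical
  calc ∑ Q ∈ F, c Q * Φ (above F K (K Q))
      = ∑ Q ∈ F, ∑ R ∈ F, if K Q ⊆ K R then c Q * incr F K Φ R else 0 := by
        refine Finset.sum_congr rfl fun Q hQ => ?_
        rw [← h.sum_incr hΦ h0 (h.nonempty Q hQ), Finset.mul_sum, above, Finset.sum_filter]
    _ = ∑ R ∈ F, incr F K Φ R * ∑ Q ∈ F with K Q ⊆ K R, c Q := by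
        rw [Finset.sum_comm]
        refine Finset.sum_congr rfl fun R _ => ?_
        rw [Finset.mul_sum, Finset.sum_filter]
        refine Finset.sum_congr rfl fun Q _ => ?_
        split_ifs
        · rw [mul_comm]
        · rfl
    _ ≤ ∑ R ∈ F, incr F K Φ R * (C * m R) := by
        refine Finset.sum_le_sum fun R hR => ?_
        gcongr
        convert hpack R hR
    _ = _ := by
        rw [Finset.mul_sum]
        exact Finset.sum_congr rfl fun R _ => by ring

variable [MeasurableSpace X] {μ : Measure X}

/-- The increments integrate to the functional of the chain through a point. -/
theorem Laminar.sum_incr_mul_setLIntegral (h : Laminar F K) {Φ : Finset ι → ℝ≥0∞}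
    (hΦ : Monotone Φ) (h0 : Φ ∅ = 0) (hK : ∀ Q ∈ F, MeasurableSet (K Q)) {f : X → ℝ≥0∞}
    (hf : AEMeasurable f μ) :
    ∑ R ∈ F, incr F K Φ R * ∫⁻ x in K R, f x ∂μ =
      ∫⁻ x, Φ (above F K {x}) * f x ∂μ := by
  classical
  have e : ∀ x, Φ (above F K {x}) * f x =
      ∑ R ∈ F, incr F K Φ R * (K R).indicator f x := by
    intro x
    rw [← h.sum_incr hΦ h0 (Set.singleton_nonempty x), Finset.sum_mul, above, Finset.sum_filter]
    refine Finset.sum_congr rfl fun R _ => ?_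
    by_cases hx : x ∈ K R <;> simp [hx]
  simp_rw [e]
  rw [lintegral_finsetSum' _ fun R hR => (hf.indicator (hK R hR)).const_mul _]
  refine Finset.sum_congr rfl fun R hR => ?_
  rw [lintegral_const_mul'' _ (hf.indicator (hK R hR)), lintegral_indicator (hK R hR)]

theorem Laminar.sum_incr_mul_measure (h : Laminar F K) {Φ : Finset ι → ℝ≥0∞}
    (hΦ : Monotone Φ) (h0 : Φ ∅ = 0) (hK : ∀ Q ∈ F, MeasurableSet (K Q)) :
    ∑ R ∈ F, incr F K Φ R * μ (K R) = ∫⁻ x, Φ (above F K {x}) ∂μ := by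
  simpa using h.sum_incr_mul_setLIntegral (μ := μ) hΦ h0 hK (f := fun _ => 1) aemeasurable_const

theorem lintegral_above_le {Φ : Finset ι → ℝ≥0∞} (h0 : Φ ∅ = 0) {A : Set X} (hA : MeasurableSet A)
    (hKA : ∀ Q ∈ F, K Q ⊆ A) {C : ℝ≥0∞} (hC : ∀ c ⊆ F, Φ c ≤ C) :
    ∫⁻ x, Φ (above F K {x}) ∂μ ≤ C * μ A := by
  rw [← lintegral_indicator_const hA]
  refine lintegral_mono fun x => ?_
  by_cases hx : x ∈ A
  · simpa [hx] using hC _ fun R hR => (mem_above.1 hR).1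
  · have : above F K {x} = ∅ := by
      ext R
      simp only [mem_above_singleton, Finset.notMem_empty, iff_false, not_and]
      exact fun hR hxR => hx (hKA R hR hxR)
    simp [this, h0]

end Laminar

section Functionals

variable {ι X : Type*} {F : Finset ι} {K : ι → Set X}

/-- The functional `c ↦ (sup_{Q ∈ c} g Q) ^ a`. -/
def supRpow (g : ι → ℝ≥0∞) (a : ℝ) (c : Finset ι) : ℝ≥0∞ := (c.sup g) ^ a

/-- The functional `c ↦ (∑_{Q ∈ c} g Q) ^ a`. -/
def sumRpow (g : ι → ℝ≥0∞) (a : ℝ) (c : Finset ι) : ℝ≥0∞ := (∑ Q ∈ c, g Q) ^ a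

theorem supRpow_mono (g : ι → ℝ≥0∞) {a : ℝ} (ha : 0 ≤ a) : Monotone (supRpow g a) :=
  fun _ _ h => ENNReal.rpow_le_rpow (Finset.sup_mono h) ha

theorem supRpow_empty (g : ι → ℝ≥0∞) {a : ℝ} (ha : 0 < a) : supRpow g a ∅ = 0 := by
  simp [supRpow, ha]

theorem sumRpow_mono (g : ι → ℝ≥0∞) {a : ℝ} (ha : 0 ≤ a) : Monotone (sumRpow g a) :=
  fun _ _ h => ENNReal.rpow_le_rpow (Finset.sum_le_sum_of_subset h) ha

theorem sumRpow_empty (g : ι → ℝ≥0∞) {a : ℝ} (ha : 0 < a) : sumRpow g a ∅ = 0 := by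
  simp [sumRpow, ha]

theorem supRpow_rpow (g : ι → ℝ≥0∞) (a b : ℝ) (c : Finset ι) :
    supRpow g a c ^ b = supRpow g (a * b) c := by
  rw [supRpow, supRpow, ENNReal.rpow_mul]

theorem sumRpow_rpow (g : ι → ℝ≥0∞) (a b : ℝ) (c : Finset ι) :
    sumRpow g a c ^ b = sumRpow g (a * b) c := by
  rw [sumRpow, sumRpow, ENNReal.rpow_mul]

theorem rpow_le_supRpow (g : ι → ℝ≥0∞) {a : ℝ} (ha : 0 ≤ a) {Q : ι} (hQ : Q ∈ F) :
    g Q ^ a ≤ supRpow g a (above F K (K Q)) :=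
  ENNReal.rpow_le_rpow (Finset.le_sup (f := g) (self_mem_above hQ)) ha

theorem supRpow_le (g : ι → ℝ≥0∞) {a : ℝ} (ha : 0 ≤ a) {c : Finset ι} {C : ℝ≥0∞}
    (h : ∀ Q ∈ c, g Q ≤ C) : supRpow g a c ≤ C ^ a :=
  ENNReal.rpow_le_rpow (Finset.sup_le h) ha

theorem sup_ne_top {g : ι → ℝ≥0∞} {c : Finset ι} (h : ∀ Q ∈ c, g Q ≠ ∞) : c.sup g ≠ ∞ :=
  ((Finset.sup_lt_iff ENNReal.zero_lt_top).2 fun Q hQ => (h Q hQ).lt_top).ne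

theorem sup_above (g : ι → ℝ≥0∞) {R : ι} (hR : R ∈ F) :
    (above F K (K R)).sup g = g R ⊔ (strictAbove F K R).sup g := by
  classical
  rw [strictAbove, ← Finset.sup_insert, Finset.insert_erase (self_mem_above hR)]

theorem sum_above (g : ι → ℝ≥0∞) {R : ι} (hR : R ∈ F) :
    ∑ Q ∈ above F K (K R), g Q = g R + ∑ Q ∈ strictAbove F K R, g Q := by
  classical
  rw [strictAbove, Finset.add_sum_erase _ _ (self_mem_above hR)]

theorem card_above {R : ι} (hR : R ∈ F) :
    (above F K (K R)).card = (strictAbove F K R).card + 1 := by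
  classical
  rw [strictAbove, Finset.card_erase_add_one (self_mem_above hR)]

theorem incr_supRpow_add_le {g : ι → ℝ≥0∞} (hg : ∀ Q ∈ F, g Q ≠ ∞) {a b : ℝ} (ha : 0 < a)
    (hb : 0 < b) {R : ι} (hR : R ∈ F) :
    incr F K (supRpow g (a + b)) R ≤
      ENNReal.ofReal ((a + b) / a) * (g R ^ b * incr F K (supRpow g a) R) := by
  simp only [incr, supRpow]
  rw [sup_above g hR]
  rcases le_total (g R) ((strictAbove F K R).sup g) with h | h
  · simp [sup_eq_right.2 h]
  · rw [sup_eq_left.2 h]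
    exact rpow_add_sub_rpow_le h (hg R hR) ha hb

theorem incr_supRpow_rpow_le (g : ι → ℝ≥0∞) {a m : ℝ} (hm : 1 ≤ m) (R : ι) :
    incr F K (supRpow g a) R ^ m ≤ incr F K (supRpow g (a * m)) R :=
  rpow_tsub_rpow_le hm

theorem incr_sumRpow_rpow_le (g : ι → ℝ≥0∞) {a m : ℝ} (hm : 1 ≤ m) (R : ι) :
    incr F K (sumRpow g a) R ^ m ≤ incr F K (sumRpow g (a * m)) R :=
  rpow_tsub_rpow_le hm

theorem incr_sumRpow_le {g : ι → ℝ≥0∞} (hg : ∀ Q ∈ F, g Q ≠ ∞) {s : ℝ} (hs : 1 < s) {R : ι}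
    (hR : R ∈ F) :
    incr F K (sumRpow g s) R ≤
      ENNReal.ofReal s * (g R * sumRpow g (s - 1) (above F K (K R))) := by
  have hfin : ∑ Q ∈ above F K (K R), g Q ≠ ∞ :=
    ENNReal.sum_ne_top.2 fun Q hQ => hg Q (mem_above.1 hQ).1
  have h := rpow_add_sub_rpow_le (x := ∑ Q ∈ above F K (K R), g Q)
    (y := ∑ Q ∈ strictAbove F K R, g Q) (a := 1) (b := s - 1)
    (Finset.sum_le_sum_of_subset (strictAbove_subset R)) hfin one_pos (by linarith)
  simp only [incr, sumRpow]
  rw [add_sub_cancel, div_one, ENNReal.rpow_one, ENNReal.rpow_one] at h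
  refine h.trans ?_
  gcongr ENNReal.ofReal s * ?_
  rw [mul_comm]
  gcongr
  rw [tsub_le_iff_right, sum_above g hR]

theorem incr_mul_le {Φ Ψ : Finset ι → ℝ≥0∞} (R : ι) :
    incr F K (fun c => Φ c * Ψ c) R ≤
      Φ (above F K (K R)) * incr F K Ψ R + incr F K Φ R * Ψ (above F K (K R)) := by
  simp only [incr]
  rw [tsub_le_iff_right]
  set a := Φ (above F K (K R))
  set a' := Φ (strictAbove F K R)
  set b := Ψ (above F K (K R))
  set b' := Ψ (strictAbove F K R)
  rcases le_total b b' with h | h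
  · calc a * b ≤ ((a - a') + a') * b := by gcongr; exact le_tsub_add
      _ = (a - a') * b + a' * b := by ring
      _ ≤ (a - a') * b + a' * b' := by gcongr
      _ ≤ _ := by rw [tsub_eq_zero_of_le h]; simp
  · rcases le_total a a' with h' | h'
    · calc a * b ≤ a * ((b - b') + b') := by gcongr; exact le_tsub_add
        _ = a * (b - b') + a * b' := by ring
        _ ≤ a * (b - b') + a' * b' := by gcongr
        _ ≤ _ := by gcongr; exact le_self_add
    · calc a * b = (a - a' + a') * (b - b' + b') := by
            rw [tsub_add_cancel_of_le h, tsub_add_cancel_of_le h']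
        _ = (a - a' + a') * (b - b') + (a - a') * b' + a' * b' := by ring
        _ ≤ _ := by
            gcongr
            · rw [tsub_add_cancel_of_le h']

theorem Laminar.measurable_above [MeasurableSpace X] (h : Laminar F K) {Φ : Finset ι → ℝ≥0∞}
    (hΦ : Monotone Φ) (h0 : Φ ∅ = 0) (hK : ∀ Q ∈ F, MeasurableSet (K Q)) :
    Measurable fun x => Φ (above F K {x}) := by
  classical
  have e : (fun x => Φ (above F K {x})) =
      fun x => ∑ R ∈ F, (K R).indicator (fun _ => incr F K Φ R) x := by
    funext x
    rw [← h.sum_incr hΦ h0 (Set.singleton_nonempty x), above, Finset.sum_filter]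
    refine Finset.sum_congr rfl fun R _ => ?_
    by_cases hx : x ∈ K R <;> simp [hx]
  rw [e]
  exact Finset.measurable_sum _ fun R hR => measurable_const.indicator (hK R hR)

/-- If `c` is the restriction of a measure and a functional is bounded by `C`, so is the sum of
its increments. -/
theorem Laminar.sum_incr_mul_measure_le [MeasurableSpace X] {μ : Measure X} (h : Laminar F K)
    {Φ : Finset ι → ℝ≥0∞} (hΦ : Monotone Φ) (h0 : Φ ∅ = 0) (hK : ∀ Q ∈ F, MeasurableSet (K Q))
    {A : Set X} (hA : MeasurableSet A) (hKA : ∀ Q ∈ F, K Q ⊆ A) {C : ℝ≥0∞}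
    (hC : ∀ c ⊆ F, Φ c ≤ C) :
    ∑ R ∈ F, incr F K Φ R * μ (K R) ≤ C * μ A := by
  rw [h.sum_incr_mul_measure hΦ h0 hK]
  exact lintegral_above_le h0 hA hKA hC

end Functionals

theorem rpow_le_of_le_mul_rpow {x c : ℝ≥0∞} {θ : ℝ} (hx : x ≠ ∞) (hθ : 0 < θ)
    (h : x ≤ c * x ^ (1 - θ)) : x ^ θ ≤ c := by
  rcases eq_or_ne x 0 with rfl | h0
  · simp [hθ]
  have h1 : x ^ (1 - θ) ≠ 0 := fun h => by
    rcases ENNReal.rpow_eq_zero_iff.1 h with h | h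
    exacts [h0 h.1, hx h.1]
  have h2 : x ^ (1 - θ) ≠ ∞ := ENNReal.rpow_ne_top_of_ne_zero h0 hx
  rw [← ENNReal.mul_le_mul_iff_left h1 h2, ← ENNReal.rpow_add _ _ h0 hx]
  simpa using h

section Maximal

variable {ι X : Type*} {F : Finset ι} {K : ι → Set X} [MeasurableSpace X] {σ : Measure X}

/-- The weighted maximal theorem for a laminar family. -/
theorem Laminar.maximal_le (h : Laminar F K) (hK : ∀ Q ∈ F, MeasurableSet (K Q))
    (hσ : ∀ Q ∈ F, σ (K Q) ≠ ∞) {g : X → ℝ≥0∞} (hg : AEMeasurable g σ) {p : ℝ} (hp : 1 < p)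
    {G : ι → ℝ≥0∞} (hG : ∀ Q ∈ F, G Q ≠ ∞) (hGg : ∀ Q ∈ F, G Q * σ (K Q) ≤ ∫⁻ x in K Q, g x ∂σ) :
    (∑ R ∈ F, incr F K (supRpow G p) R * σ (K R)) ^ (1 / p) ≤
      ENNReal.ofReal (p / (p - 1)) * (∫⁻ x, g x ^ p ∂σ) ^ (1 / p) := by
  have hp0 : 0 < p := by linarith
  have hp1 : 0 < p - 1 := by linarith
  have hX : ∑ R ∈ F, incr F K (supRpow G p) R * σ (K R) ≠ ∞ := by
    refine ENNReal.sum_ne_top.2 fun R hR => ENNReal.mul_ne_top ?_ (hσ R hR)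
    exact ne_top_of_le_ne_top (ENNReal.rpow_ne_top_of_nonneg hp0.le
      (sup_ne_top fun Q hQ => hG Q (mem_above.1 hQ).1)) tsub_le_self
  refine rpow_le_of_le_mul_rpow hX (by positivity) ?_
  have e : ∫⁻ x, supRpow G p (above F K {x}) ∂σ =
      ∑ R ∈ F, incr F K (supRpow G p) R * σ (K R) :=
    (h.sum_incr_mul_measure (supRpow_mono G hp0.le) (supRpow_empty G hp0) hK).symm
  calc ∑ R ∈ F, incr F K (supRpow G p) R * σ (K R)
      ≤ ∑ R ∈ F, ENNReal.ofReal (p / (p - 1)) *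
          (incr F K (supRpow G (p - 1)) R * ∫⁻ x in K R, g x ∂σ) := by
        refine Finset.sum_le_sum fun R hR => ?_
        have := incr_supRpow_add_le (K := K) hG hp1 one_pos hR
        rw [sub_add_cancel, ENNReal.rpow_one] at this
        calc _ ≤ ENNReal.ofReal (p / (p - 1)) * (G R * incr F K (supRpow G (p - 1)) R) * σ (K R) := by
              gcongr
          _ = ENNReal.ofReal (p / (p - 1)) * (incr F K (supRpow G (p - 1)) R * (G R * σ (K R))) := by
              ring
          _ ≤ _ := by gcongr; exact hGg R hR
    _ = ENNReal.ofReal (p / (p - 1)) * ∫⁻ x, supRpow G (p - 1) (above F K {x}) * g x ∂σ := by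
        rw [← Finset.mul_sum, h.sum_incr_mul_setLIntegral (supRpow_mono G hp1.le)
          (supRpow_empty G hp1) hK hg]
    _ = ENNReal.ofReal (p / (p - 1)) *
          ∫⁻ x, supRpow G p (above F K {x}) ^ (1 - 1 / p) * (g x ^ p) ^ (1 / p) ∂σ := by
        simp_rw [supRpow_rpow, ← ENNReal.rpow_mul, mul_one_div_cancel hp0.ne', ENNReal.rpow_one,
          mul_sub, mul_one_div_cancel hp0.ne', mul_one]
    _ ≤ ENNReal.ofReal (p / (p - 1)) *
          ((∫⁻ x, supRpow G p (above F K {x}) ∂σ) ^ (1 - 1 / p) *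
            (∫⁻ x, g x ^ p ∂σ) ^ (1 / p)) := by
        gcongr
        refine ENNReal.lintegral_mul_norm_pow_le
          (h.measurable_above (supRpow_mono G hp0.le) (supRpow_empty G hp0) hK).aemeasurable
          (hg.pow_const p) ?_ (by positivity) (by ring)
        rw [sub_nonneg, div_le_one hp0]
        exact hp.le
    _ = _ := by rw [e]; ring

end Maximal

section Packing

variable {ι X : Type*} {F : Finset ι} {K : ι → Set X}

theorem Laminar.sum_mul_pow_card_le (h : Laminar F K) {ν : ι → ℝ≥0∞} {L ν₀ : ℝ≥0∞}
    (hL0 : L ≠ 0) (hL : L ≠ ∞) (hν : ∀ Q ∈ F, ν Q ≠ ∞)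
    (hpack : ∀ R ∈ F, (open Classical in ∑ Q ∈ F with K Q ⊆ K R, ν Q) ≤ L * ν R)
    (htot : ∑ Q ∈ F, ν Q ≤ L * ν₀) :
    ∑ Q ∈ F, ν Q * (1 + (2 * L)⁻¹) ^ (above F K (K Q)).card ≤ 2 * L * ν₀ := by
  have hLt : L * (2 * L)⁻¹ = 2⁻¹ := by
    rw [ENNReal.mul_inv (Or.inl two_ne_zero) (Or.inl ENNReal.ofNat_ne_top), mul_left_comm,
      ENNReal.mul_inv_cancel hL0 hL, mul_one]
  have ht : (2 * L)⁻¹ ≠ ∞ := ENNReal.inv_ne_top.2 (mul_ne_zero two_ne_zero hL0)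
  set t : ℝ≥0∞ := (2 * L)⁻¹ with t_def
  set E := ∑ Q ∈ F, ν Q * (1 + t) ^ (above F K (K Q)).card with hE
  have hEfin : E ≠ ∞ := ENNReal.sum_ne_top.2 fun Q hQ =>
    ENNReal.mul_ne_top (hν Q hQ) (ENNReal.pow_ne_top (by simp [ht]))
  have h1t : (1 : ℝ≥0∞) ≤ 1 + t := le_self_add
  have hΦ : Monotone fun c : Finset ι => (1 + t) ^ c.card - 1 := fun c d hcd =>
    tsub_le_tsub_right (pow_le_pow_right₀ h1t (Finset.card_le_card hcd)) 1
  have hincr : ∀ R ∈ F, incr F K (fun c : Finset ι => (1 + t) ^ c.card - 1) R ≤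
      t * (1 + t) ^ (above F K (K R)).card := by
    intro R hR
    simp only [incr]
    rw [card_above hR, tsub_le_iff_right, tsub_le_iff_right, add_assoc,
      tsub_add_cancel_of_le (one_le_pow₀ h1t)]
    calc (1 + t) ^ ((strictAbove F K R).card + 1)
        = t * (1 + t) ^ (strictAbove F K R).card + (1 + t) ^ (strictAbove F K R).card := by ring
      _ ≤ _ := by gcongr; exact Nat.le_succ _
  have hmain : E ≤ 2⁻¹ * E + L * ν₀ := by
    calc E = ∑ Q ∈ F, ν Q * ((1 + t) ^ (above F K (K Q)).card - 1) + ∑ Q ∈ F, ν Q := by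
          rw [hE, ← Finset.sum_add_distrib]
          refine Finset.sum_congr rfl fun Q _ => ?_
          conv_lhs => rw [← tsub_add_cancel_of_le (one_le_pow₀ (n := (above F K (K Q)).card) h1t)]
          ring
      _ ≤ L * ∑ R ∈ F, incr F K (fun c : Finset ι => (1 + t) ^ c.card - 1) R * ν R + L * ν₀ := by
          gcongr
          exact h.sum_mul_le hΦ (by simp) hpack
      _ ≤ L * ∑ R ∈ F, t * (1 + t) ^ (above F K (K R)).card * ν R + L * ν₀ := by
          gcongr with R hR
          exact hincr R hR
      _ = L * t * E + L * ν₀ := by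
          rw [hE, mul_assoc, Finset.mul_sum, Finset.mul_sum, Finset.mul_sum]
          congr 1
          exact Finset.sum_congr rfl fun R _ => by ring
      _ = _ := by rw [hLt]
  have h2 : 2⁻¹ * E + 2⁻¹ * E = E := by
    rw [← add_mul, ENNReal.inv_two_add_inv_two, one_mul]
  have h3 : 2⁻¹ * E ≤ L * ν₀ := by
    have hfin : 2⁻¹ * E ≠ ∞ := ENNReal.mul_ne_top (by simp) hEfin
    rw [← ENNReal.add_le_add_iff_left hfin, h2]
    exact hmain
  calc E = 2 * (2⁻¹ * E) := by
        rw [← mul_assoc, ENNReal.mul_inv_cancel two_ne_zero ENNReal.ofNat_ne_top, one_mul]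
    _ ≤ 2 * (L * ν₀) := by gcongr
    _ = _ := by ring

variable [MeasurableSpace X] {σ w : Measure X}

theorem Laminar.sum_measure_mul_pow_card_le (h : Laminar F K)
    (hK : ∀ Q ∈ F, MeasurableSet (K Q)) {A : Set X} (hA : MeasurableSet A)
    (hKA : ∀ Q ∈ F, K Q ⊆ A) {d : ℝ≥0∞} (hd : d < 1) :
    ∑ Q ∈ F, σ (K Q) * d ^ (above F K (K Q)).card ≤ (1 - d)⁻¹ * σ A := by
  have hd0 : 1 - d ≠ 0 := (tsub_pos_of_lt hd).ne'
  have hd1 : 1 - d ≠ ∞ := (tsub_le_self.trans_lt ENNReal.one_lt_top).ne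
  have hΦ : Monotone fun c : Finset ι => 1 - d ^ c.card := fun c e hce =>
    tsub_le_tsub_left (pow_le_pow_right_of_le_one' hd.le (Finset.card_le_card hce)) 1
  have hincr : ∀ R ∈ F, (1 - d) * d ^ (above F K (K R)).card ≤
      incr F K (fun c : Finset ι => 1 - d ^ c.card) R := by
    intro R hR
    simp only [incr]
    rw [card_above hR]
    set M := (strictAbove F K R).card
    have hM : d ^ M ≤ 1 := pow_le_one' hd.le M
    have hne : d ^ (M + 1) ≠ ∞ := ENNReal.pow_ne_top (hd.trans ENNReal.one_lt_top).ne
    refine ENNReal.le_sub_of_add_le_right (tsub_le_self.trans_lt ENNReal.one_lt_top).ne ?_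
    refine ENNReal.le_sub_of_add_le_right hne ?_
    calc (1 - d) * d ^ (M + 1) + (1 - d ^ M) + d ^ (M + 1)
        ≤ (1 - d) * d ^ M + (1 - d ^ M) + d * d ^ M := by
          gcongr ?_ + _ + ?_
          · gcongr (1 - d) * ?_
            exact pow_le_pow_right_of_le_one' hd.le (Nat.le_succ M)
          · rw [pow_succ']
      _ = (1 - d + d) * d ^ M + (1 - d ^ M) := by ring
      _ = 1 := by
          rw [tsub_add_cancel_of_le hd.le, one_mul, add_tsub_cancel_of_le hM]
  rw [← ENNReal.mul_le_mul_iff_right hd0 hd1, ← mul_assoc, ENNReal.mul_inv_cancel hd0 hd1, one_mul,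
    Finset.mul_sum]
  calc ∑ Q ∈ F, (1 - d) * (σ (K Q) * d ^ (above F K (K Q)).card)
      ≤ ∑ Q ∈ F, incr F K (fun c : Finset ι => 1 - d ^ c.card) Q * σ (K Q) := by
        refine Finset.sum_le_sum fun Q hQ => ?_
        calc _ = (1 - d) * d ^ (above F K (K Q)).card * σ (K Q) := by ring
          _ ≤ _ := by gcongr; exact hincr Q hQ
    _ ≤ 1 * σ A := h.sum_incr_mul_measure_le hΦ (by simp) hK hA hKA fun c _ => tsub_le_self
    _ = σ A := one_mul _

/-- Packing of the homogeneous quantities `|Q|^a σ(Q)^b w(Q)^c` with `a + b + c = 1`, `a > 0`. -/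
theorem exists_packing_const (ι X : Type*) [MeasurableSpace X] {L : ℝ≥0∞} (hL0 : L ≠ 0)
    (hL : L ≠ ∞) {a b c : ℝ} (ha : 0 < a) (hb : 0 ≤ b) (hc : 0 ≤ c) (hbc : 0 < b + c)
    (habc : a + b + c = 1) :
    ∃ C : ℝ≥0∞, C ≠ ∞ ∧ ∀ (F : Finset ι) (K : ι → Set X), Laminar F K →
      (∀ Q ∈ F, MeasurableSet (K Q)) → ∀ (σ w : Measure X) (ν : ι → ℝ≥0∞) (ν₀ : ℝ≥0∞) (A : Set X),
      MeasurableSet A → (∀ Q ∈ F, K Q ⊆ A) → (∀ Q ∈ F, ν Q ≠ ∞) →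
      (∀ R ∈ F, (open Classical in ∑ Q ∈ F with K Q ⊆ K R, ν Q) ≤ L * ν R) →
      ∑ Q ∈ F, ν Q ≤ L * ν₀ →
      ∑ Q ∈ F, ν Q ^ a * (σ (K Q) ^ b * w (K Q) ^ c) ≤ C * (ν₀ ^ a * (σ A ^ b * w A ^ c)) := by
  set k : ℝ≥0∞ := 1 + (2 * L)⁻¹ with hk
  have ht : (2 * L)⁻¹ ≠ ∞ := ENNReal.inv_ne_top.2 (mul_ne_zero two_ne_zero hL0)
  have ht0 : (2 * L)⁻¹ ≠ 0 := ENNReal.inv_ne_zero.2 (ENNReal.mul_ne_top ENNReal.ofNat_ne_top hL)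
  have hk1 : 1 < k := ENNReal.lt_add_right ENNReal.one_ne_top ht0
  have hkt : k ≠ ∞ := by simp [hk, ht]
  have hk0 : k ≠ 0 := (zero_lt_one.trans hk1).ne'
  set d : ℝ≥0∞ := k ^ (-(a / (b + c))) with hd
  have hd1 : d < 1 := by
    rw [hd, ENNReal.rpow_neg, ENNReal.inv_lt_one]
    exact ENNReal.one_lt_rpow hk1 (by positivity)
  have hdd : (1 - d)⁻¹ ≠ ∞ := ENNReal.inv_ne_top.2 (tsub_pos_of_lt hd1).ne'
  refine ⟨(2 * L) ^ a * ((1 - d)⁻¹ ^ b * (1 - d)⁻¹ ^ c), ?_, ?_⟩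
  · refine ENNReal.mul_ne_top (ENNReal.rpow_ne_top_of_nonneg ha.le
      (ENNReal.mul_ne_top ENNReal.ofNat_ne_top hL)) (ENNReal.mul_ne_top ?_ ?_) <;>
    exact ENNReal.rpow_ne_top_of_nonneg (by assumption) hdd
  intro F K h hK σ w ν ν₀ A hA hKA hν hpack htot
  have hone : ∀ N : ℕ, (k ^ N) ^ a * ((d ^ N) ^ b * (d ^ N) ^ c) = 1 := by
    intro N
    rw [← ENNReal.rpow_add_of_nonneg _ _ hb hc]
    simp_rw [hd, ← ENNReal.rpow_natCast, ← ENNReal.rpow_mul]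
    rw [← ENNReal.rpow_add _ _ hk0 hkt]
    convert ENNReal.rpow_zero
    field_simp
    ring
  calc ∑ Q ∈ F, ν Q ^ a * (σ (K Q) ^ b * w (K Q) ^ c)
      = ∑ Q ∈ F, (ν Q * k ^ (above F K (K Q)).card) ^ a *
          ((σ (K Q) * d ^ (above F K (K Q)).card) ^ b *
            (w (K Q) * d ^ (above F K (K Q)).card) ^ c) := by
        refine Finset.sum_congr rfl fun Q _ => ?_
        rw [ENNReal.mul_rpow_of_nonneg _ _ ha.le, ENNReal.mul_rpow_of_nonneg _ _ hb,
          ENNReal.mul_rpow_of_nonneg _ _ hc]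
        calc _ = ν Q ^ a * (σ (K Q) ^ b * w (K Q) ^ c) * 1 := (mul_one _).symm
          _ = _ := by rw [← hone (above F K (K Q)).card]; ring
    _ ≤ _ := sum_rpow_mul_rpow_mul_rpow_le F _ _ _ ha.le hb hc hbc habc
    _ ≤ (2 * L * ν₀) ^ a * (((1 - d)⁻¹ * σ A) ^ b * ((1 - d)⁻¹ * w A) ^ c) := by
        gcongr
        · exact h.sum_mul_pow_card_le hL0 hL hν hpack htot
        · exact h.sum_measure_mul_pow_card_le hK hA hKA hd1
        · exact h.sum_measure_mul_pow_card_le hK hA hKA hd1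
    _ = _ := by
        rw [ENNReal.mul_rpow_of_nonneg _ _ ha.le, ENNReal.mul_rpow_of_nonneg _ _ hb,
          ENNReal.mul_rpow_of_nonneg _ _ hc]
        ring

end Packing

theorem exists_eq_ofReal_exp {x : ℝ≥0∞} (h0 : x ≠ 0) (h : x ≠ ∞) :
    ∃ a : ℝ, x = ENNReal.ofReal (Real.exp a) :=
  ⟨Real.log x.toReal, by rw [Real.exp_log (ENNReal.toReal_pos h0 h), ENNReal.ofReal_toReal h]⟩

theorem ofReal_exp_rpow (a t : ℝ) :
    ENNReal.ofReal (Real.exp a) ^ t = ENNReal.ofReal (Real.exp (a * t)) := by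
  rw [ENNReal.ofReal_rpow_of_pos (Real.exp_pos a), Real.exp_mul]

theorem ofReal_exp_mul (a b : ℝ) :
    ENNReal.ofReal (Real.exp a) * ENNReal.ofReal (Real.exp b) = ENNReal.ofReal (Real.exp (a + b)) := by
  rw [← ENNReal.ofReal_mul (Real.exp_pos a).le, Real.exp_add]

section Packing

variable {ι X : Type*} {K : ι → Set X}

theorem packing_mono {F G : Finset ι} (hGF : G ⊆ F) {c m : ι → ℝ≥0∞} {C : ℝ≥0∞}
    (hpack : ∀ R ∈ F, (open Classical in ∑ Q ∈ F with K Q ⊆ K R, c Q) ≤ C * m R) :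
    ∀ R ∈ G, (open Classical in ∑ Q ∈ G with K Q ⊆ K R, c Q) ≤ C * m R := fun R hR => by
  classical
  exact (Finset.sum_le_sum_of_subset (Finset.filter_subset_filter _ hGF)).trans (hpack R (hGF hR))

/-- Packing of the testing sums under a two-weight characteristic bound. -/
theorem exists_testing_const (ι X : Type*) [MeasurableSpace X] {L : ℝ≥0∞} (hL0 : L ≠ 0)
    (hL : L ≠ ∞) {p q r α : ℝ} (hp : 1 < p) (hpq : p ≤ q) (hr : 0 < r) (hrq : r < q)
    (hα : 1 / q + (1 - 1 / p) = α) :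
    ∃ C : ℝ≥0∞, C ≠ ∞ ∧ ∀ (F : Finset ι) (K : ι → Set X), Laminar F K →
      (∀ Q ∈ F, MeasurableSet (K Q)) → ∀ (σ w : Measure X) (ν : ι → ℝ≥0∞) (T : ℝ≥0∞),
      (∀ Q ∈ F, ν Q ≠ 0 ∧ ν Q ≠ ∞) → (∀ Q ∈ F, σ (K Q) ≠ 0 ∧ σ (K Q) ≠ ∞) →
      (∀ Q ∈ F, w (K Q) ≠ 0 ∧ w (K Q) ≠ ∞) →
      (∀ R ∈ F, (open Classical in ∑ Q ∈ F with K Q ⊆ K R, ν Q) ≤ L * ν R) →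
      (∀ Q ∈ F, ν Q ^ (-α) * w (K Q) ^ (1 / q) * σ (K Q) ^ (1 - 1 / p) ≤ T) →
      ∀ R ∈ F, (open Classical in
        ∑ Q ∈ F with K Q ⊆ K R, (ν Q ^ (-α) * σ (K Q)) ^ r * w (K Q)) ≤
          C * (T ^ r * (σ (K R) ^ (r / p) * w (K R) ^ (1 - r / q))) := by
  have hp0 : 0 < p := by linarith
  have hq0 : 0 < q := by linarith
  have hp1 : 1 / p < 1 := by rw [div_lt_one hp0]; exact hp
  have hα0 : 0 < α := by have : 0 < 1 / q := by positivity
                         linarith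
  have hα1 : α ≤ 1 := by
    have : 1 / q ≤ 1 / p := one_div_le_one_div_of_le hp0 hpq
    linarith
  have hrq1 : r / q < 1 := by rw [div_lt_one hq0]; exact hrq
  have hrq0 : 0 < r / q := by positivity
  have hrpq : 0 ≤ r / p - r / q := by
    have : r / q ≤ r / p := div_le_div_of_nonneg_left hr.le hp0 hpq
    linarith
  obtain ⟨ε, hε0, hε1, hε2⟩ : ∃ ε : ℝ, 0 < ε ∧ ε ≤ r / q ∧ ε / q ≤ 1 - r / q := by
    refine ⟨min (r / q) (q - r), lt_min hrq0 (by linarith), min_le_left _ _, ?_⟩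
    have h : min (r / q) (q - r) ≤ q - r := min_le_right _ _
    calc _ ≤ (q - r) / q := by gcongr
      _ = _ := by field_simp
  have he0 : 0 < α * ε := by positivity
  have he1 : 0 ≤ r / q - ε * (1 - 1 / p) := by
    have : ε * (1 - 1 / p) ≤ ε * 1 := by
      gcongr
      have : 0 < 1 / p := by positivity
      linarith
    linarith
  have he2 : 0 ≤ 1 - r / q - ε / q := by linarith
  have hsum : α * ε + (r / q - ε * (1 - 1 / p)) + (1 - r / q - ε / q) = 1 := by
    rw [← hα]; ring
  have he12 : 0 < r / q - ε * (1 - 1 / p) + (1 - r / q - ε / q) := by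
    have : α * ε ≤ 1 * ε := by gcongr
    linarith
  obtain ⟨C, hC, hmain⟩ := exists_packing_const ι X hL0 hL he0 he1 he2 he12 hsum
  refine ⟨C * ENNReal.ofReal ((r + ε) / r), ENNReal.mul_ne_top hC ENNReal.ofReal_ne_top, ?_⟩
  intro F K h hK σ w ν T hν hσ hw hpack hT R hR
  classical
  set G := F.filter (fun Q => K Q ⊆ K R) with hG
  have hGF : G ⊆ F := Finset.filter_subset _ _
  have hGR : ∀ Q ∈ G, K Q ⊆ K R := fun Q hQ => (Finset.mem_filter.1 hQ).2
  set m : ι → ℝ≥0∞ := fun Q => ν Q ^ (α * ε) *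
    (σ (K Q) ^ (r / q - ε * (1 - 1 / p)) * w (K Q) ^ (1 - r / q - ε / q)) with hm
  set τ : ι → ℝ≥0∞ := fun Q => ν Q ^ (-α) * w (K Q) ^ (1 / q) * σ (K Q) ^ (1 - 1 / p) with hτ
  have hid : ∀ Q ∈ F, τ Q ≠ ∞ ∧
      (ν Q ^ (-α) * σ (K Q)) ^ r * w (K Q) =
        σ (K Q) ^ (r / p - r / q) * (m Q * τ Q ^ (r + ε)) ∧
      m Q * τ Q ^ ε = σ (K Q) ^ (r / q) * w (K Q) ^ (1 - r / q) := by
    intro Q hQ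
    obtain ⟨a, ha⟩ := exists_eq_ofReal_exp (hν Q hQ).1 (hν Q hQ).2
    obtain ⟨b, hb⟩ := exists_eq_ofReal_exp (hσ Q hQ).1 (hσ Q hQ).2
    obtain ⟨c, hc⟩ := exists_eq_ofReal_exp (hw Q hQ).1 (hw Q hQ).2
    simp only [hm, hτ, ha, hb, hc, ofReal_exp_rpow, ofReal_exp_mul]
    refine ⟨ENNReal.ofReal_ne_top, ?_, ?_⟩ <;> congr 2 <;> ring
  have hGL := h.mono hGF
  have hΦ := supRpow_mono τ (a := r + ε) (by positivity)
  have hΦ0 := supRpow_empty τ (a := r + ε) (by positivity)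
  have hpackm : ∀ R' ∈ G, (open Classical in ∑ Q ∈ G with K Q ⊆ K R', m Q) ≤ C * m R' := by
    intro R' hR'
    have hsub : G.filter (fun Q => K Q ⊆ K R') ⊆ F := (Finset.filter_subset _ _).trans hGF
    refine hmain _ K (h.mono hsub) (fun Q hQ => hK Q (hsub hQ)) σ w ν (ν R') (K R')
      (hK R' (hGF hR')) (fun Q hQ => (Finset.mem_filter.1 hQ).2)
      (fun Q hQ => (hν Q (hsub hQ)).2) (packing_mono hsub hpack) ?_
    exact packing_mono hGF hpack R' hR'
  have hstep : ∑ Q ∈ G, m Q * τ Q ^ (r + ε) ≤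
      C * ENNReal.ofReal ((r + ε) / r) * (T ^ r * (σ (K R) ^ (r / q) * w (K R) ^ (1 - r / q))) := by
    calc ∑ Q ∈ G, m Q * τ Q ^ (r + ε)
        ≤ ∑ Q ∈ G, m Q * supRpow τ (r + ε) (above G K (K Q)) := by
          gcongr with Q hQ
          exact rpow_le_supRpow τ (by positivity) hQ
      _ ≤ C * ∑ Q ∈ G, incr G K (supRpow τ (r + ε)) Q * m Q := hGL.sum_mul_le hΦ hΦ0 hpackm
      _ ≤ C * ∑ Q ∈ G, ENNReal.ofReal ((r + ε) / r) *
            ((incr G K (supRpow τ r) Q * σ (K Q)) ^ (r / q) *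
              (incr G K (supRpow τ r) Q * w (K Q)) ^ (1 - r / q)) := by
          gcongr C * ?_
          refine Finset.sum_le_sum fun Q hQ => ?_
          have h1 := incr_supRpow_add_le (F := G) (K := K) (g := τ)
            (fun Q hQ => (hid Q (hGF hQ)).1) hr hε0 hQ
          refine (mul_le_mul_left h1 _).trans_eq ?_
          rw [ENNReal.mul_rpow_of_nonneg _ _ hrq0.le,
            ENNReal.mul_rpow_of_nonneg _ _ (by linarith : 0 ≤ 1 - r / q)]
          have h2 : incr G K (supRpow τ r) Q =
              incr G K (supRpow τ r) Q ^ (r / q) * incr G K (supRpow τ r) Q ^ (1 - r / q) := by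
            rw [← ENNReal.rpow_add_of_nonneg _ _ hrq0.le (by linarith), add_sub_cancel,
              ENNReal.rpow_one]
          calc _ = ENNReal.ofReal ((r + ε) / r) * (incr G K (supRpow τ r) Q * (m Q * τ Q ^ ε)) := by
                ring
            _ = _ := by
                rw [(hid Q (hGF hQ)).2.2]
                nth_rw 1 [h2]
                ring
      _ ≤ C * (ENNReal.ofReal ((r + ε) / r) *
            ((T ^ r * σ (K R)) ^ (r / q) * (T ^ r * w (K R)) ^ (1 - r / q))) := by
          rw [← Finset.mul_sum]
          gcongr
          refine (sum_rpow_mul_rpow_le G _ _ hrq0.le (by linarith) (by ring)).trans ?_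
          have hle : ∀ c ⊆ G, supRpow τ r c ≤ T ^ r := fun c hc =>
            supRpow_le τ hr.le fun Q hQ => hT Q (hGF (hc hQ))
          gcongr
          · exact hGL.sum_incr_mul_measure_le (supRpow_mono τ hr.le) (supRpow_empty τ hr)
              (fun Q hQ => hK Q (hGF hQ)) (hK R hR) hGR hle
          · exact hGL.sum_incr_mul_measure_le (supRpow_mono τ hr.le) (supRpow_empty τ hr)
              (fun Q hQ => hK Q (hGF hQ)) (hK R hR) hGR hle
      _ = _ := by
          rw [ENNReal.mul_rpow_of_nonneg _ _ hrq0.le,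
            ENNReal.mul_rpow_of_nonneg _ _ (by linarith : 0 ≤ 1 - r / q)]
          have h2 : T ^ r = (T ^ r) ^ (r / q) * (T ^ r) ^ (1 - r / q) := by
            rw [← ENNReal.rpow_add_of_nonneg _ _ hrq0.le (by linarith), add_sub_cancel,
              ENNReal.rpow_one]
          nth_rw 3 [h2]
          ring
  calc _ = ∑ Q ∈ G, σ (K Q) ^ (r / p - r / q) * (m Q * τ Q ^ (r + ε)) :=
        Finset.sum_congr rfl fun Q hQ => (hid Q (hGF hQ)).2.1
    _ ≤ ∑ Q ∈ G, σ (K R) ^ (r / p - r / q) * (m Q * τ Q ^ (r + ε)) := by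
        gcongr with Q hQ
        exact hGR Q hQ
    _ ≤ σ (K R) ^ (r / p - r / q) * (C * ENNReal.ofReal ((r + ε) / r) *
          (T ^ r * (σ (K R) ^ (r / q) * w (K R) ^ (1 - r / q)))) := by
        rw [← Finset.mul_sum]
        gcongr
    _ = _ := by
        have h2 : σ (K R) ^ (r / p) = σ (K R) ^ (r / p - r / q) * σ (K R) ^ (r / q) := by
          rw [← ENNReal.rpow_add_of_nonneg _ _ hrpq hrq0.le, sub_add_cancel]
        rw [h2]
        ring

end Packing

section Weighted

variable {ι X : Type*} {F : Finset ι} {K : ι → Set X} [MeasurableSpace X] {σ w : Measure X}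

theorem Laminar.above_mul_measure_le {μ : Measure X} (h : Laminar F K) {Φ : Finset ι → ℝ≥0∞}
    (hΦ : Monotone Φ) (h0 : Φ ∅ = 0) {R : ι} (hR : R ∈ F) :
    Φ (above F K (K R)) * μ (K R) ≤ ∑ Q ∈ F, incr F K Φ Q * μ (K Q) := by
  rw [← h.sum_incr hΦ h0 (h.nonempty R hR), Finset.sum_mul]
  calc ∑ Q ∈ above F K (K R), incr F K Φ Q * μ (K R)
      ≤ ∑ Q ∈ above F K (K R), incr F K Φ Q * μ (K Q) := by
        gcongr with Q hQ
        exact (mem_above.1 hQ).2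
    _ ≤ _ := Finset.sum_le_sum_of_subset fun Q hQ => (mem_above.1 hQ).1

theorem rpow_mul_rpow_of_add {x : ℝ≥0∞} {a b c : ℝ} (ha : 0 ≤ a) (hb : 0 ≤ b) (h : a + b = c) :
    x ^ a * x ^ b = x ^ c := by
  rw [← ENNReal.rpow_add_of_nonneg _ _ ha hb, h]

theorem rpow_le_rpow_mul_rpow {x y : ℝ≥0∞} {a b c : ℝ} (hxy : x ≤ y) (ha : 0 ≤ a) (hb : 0 ≤ b)
    (h : a + b = c) : x ^ c ≤ y ^ a * x ^ b := by
  rw [← rpow_mul_rpow_of_add ha hb h]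
  gcongr

variable {p q r : ℝ} {G a : ι → ℝ≥0∞} {A B : ℝ≥0∞}

theorem Laminar.sum_supRpow_mul_incr_sumRpow_le (h : Laminar F K) (hr : 0 < r) (hrq : r < q)
    (hp0 : 0 < p) (hpq : p ≤ q)
    (hA : ∀ R ∈ F, (open Classical in ∑ Q ∈ F with K Q ⊆ K R, σ (K Q)) ≤ A * σ (K R)) :
    ∑ R ∈ F, supRpow G r (above F K (K R)) * incr F K (sumRpow a (q / r - 1)) R *
        (σ (K R) ^ (r / p) * w (K R) ^ (1 - r / q)) ≤
      (∑ R ∈ F, incr F K (supRpow G p) R * σ (K R)) ^ (r / p) * A ^ (r / q) *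
        (∑ R ∈ F, incr F K (sumRpow a (q / r)) R * w (K R)) ^ (1 - r / q) := by
  have hq0 : 0 < q := by linarith
  have hθ0 : 0 < r / q := by positivity
  have hθ1 : 0 < 1 - r / q := by rw [sub_pos, div_lt_one hq0]; exact hrq
  have hs : 0 < q / r - 1 := by rw [sub_pos, one_lt_div hr]; exact hrq
  have hpq' : 0 ≤ r / p - r / q :=
    sub_nonneg.2 (div_le_div_of_nonneg_left hr.le hp0 hpq)
  set S := ∑ R ∈ F, incr F K (supRpow G p) R * σ (K R) with hS
  set Z := ∑ R ∈ F, incr F K (sumRpow a (q / r)) R * w (K R) with hZ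
  have hΦ := supRpow_mono G hp0.le
  have hΦ0 := supRpow_empty G hp0
  calc _ ≤ ∑ R ∈ F, S ^ (r / p - r / q) *
        ((σ (K R) * supRpow G p (above F K (K R))) ^ (r / q) *
          (incr F K (sumRpow a (q / r)) R * w (K R)) ^ (1 - r / q)) := by
        refine Finset.sum_le_sum fun R hR => ?_
        have h1 : supRpow G r (above F K (K R)) * σ (K R) ^ (r / p) ≤
            S ^ (r / p - r / q) * (σ (K R) * supRpow G p (above F K (K R))) ^ (r / q) := by
          have e : supRpow G r (above F K (K R)) = supRpow G p (above F K (K R)) ^ (r / p) := by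
            rw [supRpow_rpow, mul_div_cancel₀ _ hp0.ne']
          rw [e, ← ENNReal.mul_rpow_of_nonneg _ _ (by positivity), mul_comm (σ (K R))]
          exact rpow_le_rpow_mul_rpow (h.above_mul_measure_le hΦ hΦ0 hR) hpq' hθ0.le (by ring)
        have h2 : incr F K (sumRpow a (q / r - 1)) R * w (K R) ^ (1 - r / q) ≤
            (incr F K (sumRpow a (q / r)) R * w (K R)) ^ (1 - r / q) := by
          rw [ENNReal.mul_rpow_of_nonneg _ _ hθ1.le]
          gcongr
          have h3 := incr_sumRpow_rpow_le (F := F) (K := K) a (a := q / r - 1)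
            (m := (1 - r / q)⁻¹) ((one_le_inv₀ hθ1).2 (by linarith)) R
          have e : (q / r - 1) * (1 - r / q)⁻¹ = q / r := by
            have : q - r ≠ 0 := by linarith
            field_simp
          rw [e] at h3
          have h4 := ENNReal.rpow_le_rpow h3 hθ1.le
          rwa [← ENNReal.rpow_mul, inv_mul_cancel₀ hθ1.ne', ENNReal.rpow_one] at h4
        calc _ = (supRpow G r (above F K (K R)) * σ (K R) ^ (r / p)) *
              (incr F K (sumRpow a (q / r - 1)) R * w (K R) ^ (1 - r / q)) := by ring
          _ ≤ _ := mul_le_mul' h1 h2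
          _ = _ := by ring
    _ ≤ S ^ (r / p - r / q) * ((A * S) ^ (r / q) * Z ^ (1 - r / q)) := by
        rw [← Finset.mul_sum]
        gcongr
        refine (sum_rpow_mul_rpow_le F _ _ hθ0.le hθ1.le (by ring)).trans ?_
        gcongr
        exact h.sum_mul_le hΦ hΦ0 hA
    _ = _ := by
        rw [ENNReal.mul_rpow_of_nonneg _ _ hθ0.le,
          ← rpow_mul_rpow_of_add hpq' hθ0.le (sub_add_cancel (r / p) (r / q))]
        ring

theorem Laminar.sum_incr_supRpow_mul_sumRpow_le (h : Laminar F K) (hr : 0 < r) (hrp : r ≤ p)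
    (hrq : r < q) (hpq : p ≤ q)
    (hB : ∀ R ∈ F, (open Classical in ∑ Q ∈ F with K Q ⊆ K R, w (K Q)) ≤ B * w (K R)) :
    ∑ R ∈ F, incr F K (supRpow G r) R * sumRpow a (q / r - 1) (above F K (K R)) *
        (σ (K R) ^ (r / p) * w (K R) ^ (1 - r / q)) ≤
      (∑ R ∈ F, incr F K (supRpow G p) R * σ (K R)) ^ (r / p) * B ^ (1 - r / p) *
        (∑ R ∈ F, incr F K (sumRpow a (q / r)) R * w (K R)) ^ (1 - r / q) := by
  have hq0 : 0 < q := by linarith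
  have hp0 : 0 < p := by linarith
  have hθ1 : 0 < 1 - r / q := by rw [sub_pos, div_lt_one hq0]; exact hrq
  have hrp0 : 0 < r / p := by positivity
  have hrp1 : 0 ≤ 1 - r / p := by rw [sub_nonneg, div_le_one hp0]; exact hrp
  have hs : 0 < q / r := by positivity
  have hpq' : 0 ≤ r / p - r / q :=
    sub_nonneg.2 (div_le_div_of_nonneg_left hr.le hp0 hpq)
  set S := ∑ R ∈ F, incr F K (supRpow G p) R * σ (K R) with hS
  set Z := ∑ R ∈ F, incr F K (sumRpow a (q / r)) R * w (K R) with hZ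
  have hΦ := sumRpow_mono a hs.le
  have hΦ0 := sumRpow_empty a hs
  calc _ ≤ ∑ R ∈ F, Z ^ (r / p - r / q) *
        ((incr F K (supRpow G p) R * σ (K R)) ^ (r / p) *
          (w (K R) * sumRpow a (q / r) (above F K (K R))) ^ (1 - r / p)) := by
        refine Finset.sum_le_sum fun R hR => ?_
        have h1 : sumRpow a (q / r - 1) (above F K (K R)) * w (K R) ^ (1 - r / q) ≤
            Z ^ (r / p - r / q) *
              (w (K R) * sumRpow a (q / r) (above F K (K R))) ^ (1 - r / p) := by
          have e : sumRpow a (q / r - 1) (above F K (K R)) =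
              sumRpow a (q / r) (above F K (K R)) ^ (1 - r / q) := by
            rw [sumRpow_rpow]
            congr 1
            field_simp
          rw [e, ← ENNReal.mul_rpow_of_nonneg _ _ hθ1.le, mul_comm (w (K R))]
          exact rpow_le_rpow_mul_rpow (h.above_mul_measure_le hΦ hΦ0 hR) hpq' hrp1 (by ring)
        have h2 : incr F K (supRpow G r) R * σ (K R) ^ (r / p) ≤
            (incr F K (supRpow G p) R * σ (K R)) ^ (r / p) := by
          rw [ENNReal.mul_rpow_of_nonneg _ _ hrp0.le]
          gcongr
          have h3 := incr_supRpow_rpow_le (F := F) (K := K) G (a := r)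
            (m := (r / p)⁻¹) ((one_le_inv₀ hrp0).2 (by linarith)) R
          have e : r * (r / p)⁻¹ = p := by field_simp
          rw [e] at h3
          have h4 := ENNReal.rpow_le_rpow h3 hrp0.le
          rwa [← ENNReal.rpow_mul, inv_mul_cancel₀ hrp0.ne', ENNReal.rpow_one] at h4
        calc _ = (incr F K (supRpow G r) R * σ (K R) ^ (r / p)) *
              (sumRpow a (q / r - 1) (above F K (K R)) * w (K R) ^ (1 - r / q)) := by ring
          _ ≤ _ := mul_le_mul' h2 h1
          _ = _ := by ring
    _ ≤ Z ^ (r / p - r / q) * (S ^ (r / p) * (B * Z) ^ (1 - r / p)) := by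
        rw [← Finset.mul_sum]
        gcongr
        refine (sum_rpow_mul_rpow_le F _ _ hrp0.le hrp1 (by ring)).trans ?_
        gcongr
        exact h.sum_mul_le hΦ hΦ0 hB
    _ = _ := by
        rw [ENNReal.mul_rpow_of_nonneg _ _ hrp1, ← rpow_mul_rpow_of_add hpq' hrp1
          (by ring : r / p - r / q + (1 - r / p) = 1 - r / q)]
        ring

theorem Laminar.sum_incr_sumRpow_le (h : Laminar F K) (hr : 0 < r) (hrp : r ≤ p)
    (hrq : r < q) (hpq : p ≤ q) (ha : ∀ Q ∈ F, a Q ≠ ∞) (hw : ∀ Q ∈ F, w (K Q) ≠ ∞)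
    {c : ι → ℝ≥0∞} {D : ℝ≥0∞} (hac : ∀ Q ∈ F, a Q * w (K Q) ≤ c Q * G Q ^ r)
    (hc : ∀ R ∈ F, (open Classical in ∑ Q ∈ F with K Q ⊆ K R, c Q) ≤
      D * (σ (K R) ^ (r / p) * w (K R) ^ (1 - r / q)))
    (hA : ∀ R ∈ F, (open Classical in ∑ Q ∈ F with K Q ⊆ K R, σ (K Q)) ≤ A * σ (K R))
    (hB : ∀ R ∈ F, (open Classical in ∑ Q ∈ F with K Q ⊆ K R, w (K Q)) ≤ B * w (K R)) :
    (∑ R ∈ F, incr F K (sumRpow a (q / r)) R * w (K R)) ^ (r / q) ≤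
      ENNReal.ofReal (q / r) * D * (∑ R ∈ F, incr F K (supRpow G p) R * σ (K R)) ^ (r / p) *
        (A ^ (r / q) + B ^ (1 - r / p)) := by
  have hq0 : 0 < q := by linarith
  have hs : 0 < q / r := by positivity
  have hs1 : 1 < q / r := by rw [one_lt_div hr]; exact hrq
  have hZ : ∑ R ∈ F, incr F K (sumRpow a (q / r)) R * w (K R) ≠ ∞ := by
    refine ENNReal.sum_ne_top.2 fun R hR => ENNReal.mul_ne_top ?_ (hw R hR)
    exact ne_top_of_le_ne_top (ENNReal.rpow_ne_top_of_nonneg hs.le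
      (ENNReal.sum_ne_top.2 fun Q hQ => ha Q (mem_above.1 hQ).1)) tsub_le_self
  refine rpow_le_of_le_mul_rpow hZ (by positivity) ?_
  set Ψ : Finset ι → ℝ≥0∞ := fun d => supRpow G r d * sumRpow a (q / r - 1) d with hΨ
  have hΨm : Monotone Ψ := fun d e hde =>
    mul_le_mul' (supRpow_mono G hr.le hde) (sumRpow_mono a (by linarith) hde)
  have hΨ0 : Ψ ∅ = 0 := by simp [hΨ, supRpow_empty G hr]
  calc _ ≤ ∑ R ∈ F, ENNReal.ofReal (q / r) * (c R * Ψ (above F K (K R))) := by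
        refine Finset.sum_le_sum fun R hR => ?_
        calc _ ≤ ENNReal.ofReal (q / r) * (a R * sumRpow a (q / r - 1) (above F K (K R))) *
              w (K R) := by
              gcongr
              exact incr_sumRpow_le ha hs1 hR
          _ = ENNReal.ofReal (q / r) * ((a R * w (K R)) *
                sumRpow a (q / r - 1) (above F K (K R))) := by ring
          _ ≤ ENNReal.ofReal (q / r) * ((c R * supRpow G r (above F K (K R))) *
                sumRpow a (q / r - 1) (above F K (K R))) := by
              refine mul_le_mul_right (mul_le_mul_left ((hac R hR).trans ?_) _) _
              gcongr
              exact rpow_le_supRpow G hr.le hR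
          _ = _ := by simp only [hΨ]; ring
    _ ≤ ENNReal.ofReal (q / r) * (D * ∑ R ∈ F, incr F K Ψ R *
          (σ (K R) ^ (r / p) * w (K R) ^ (1 - r / q))) := by
        rw [← Finset.mul_sum]
        gcongr
        exact h.sum_mul_le hΨm hΨ0 hc
    _ ≤ ENNReal.ofReal (q / r) * (D * (
          ∑ R ∈ F, supRpow G r (above F K (K R)) * incr F K (sumRpow a (q / r - 1)) R *
            (σ (K R) ^ (r / p) * w (K R) ^ (1 - r / q)) +
          ∑ R ∈ F, incr F K (supRpow G r) R * sumRpow a (q / r - 1) (above F K (K R)) *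
            (σ (K R) ^ (r / p) * w (K R) ^ (1 - r / q)))) := by
        rw [← Finset.sum_add_distrib]
        gcongr with R hR
        rw [← add_mul]
        gcongr
        exact incr_mul_le R
    _ ≤ _ := by
        refine (mul_le_mul_right (mul_le_mul_right (add_le_add
          (h.sum_supRpow_mul_incr_sumRpow_le hr hrq (by linarith) hpq hA)
          (h.sum_incr_supRpow_mul_sumRpow_le hr hrp hrq hpq hB)) _) _).trans_eq ?_
        ring

/-- The weighted bound for square-function-type sums over a laminar family. -/
theorem exists_weighted_const (ι X : Type*) [MeasurableSpace X] {L : ℝ≥0∞} (hL0 : L ≠ 0)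
    (hL : L ≠ ∞) {p q r α : ℝ} (hp : 1 < p) (hpq : p ≤ q) (hr : 1 ≤ r) (hrp : r ≤ p)
    (hrq : r < q) (hα : 1 / q + (1 - 1 / p) = α) :
    ∃ C : ℝ≥0∞, C ≠ ∞ ∧ ∀ (F : Finset ι) (K : ι → Set X), Laminar F K →
      (∀ Q ∈ F, MeasurableSet (K Q)) → ∀ (σ w : Measure X) (ν : ι → ℝ≥0∞) (T A B : ℝ≥0∞)
      (g : X → ℝ≥0∞), AEMeasurable g σ → ∫⁻ x, g x ^ p ∂σ ≠ ∞ →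
      (∀ Q ∈ F, ν Q ≠ 0 ∧ ν Q ≠ ∞) → (∀ Q ∈ F, σ (K Q) ≠ 0 ∧ σ (K Q) ≠ ∞) →
      (∀ Q ∈ F, w (K Q) ≠ 0 ∧ w (K Q) ≠ ∞) →
      (∀ R ∈ F, (open Classical in ∑ Q ∈ F with K Q ⊆ K R, ν Q) ≤ L * ν R) →
      (∀ R ∈ F, (open Classical in ∑ Q ∈ F with K Q ⊆ K R, σ (K Q)) ≤ A * σ (K R)) →
      (∀ R ∈ F, (open Classical in ∑ Q ∈ F with K Q ⊆ K R, w (K Q)) ≤ B * w (K R)) →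
      (∀ Q ∈ F, ν Q ^ (-α) * w (K Q) ^ (1 / q) * σ (K Q) ^ (1 - 1 / p) ≤ T) →
      (∫⁻ x, sumRpow (fun Q => (ν Q ^ (-α) * ∫⁻ y in K Q, g y ∂σ) ^ r) (q / r)
          (above F K {x}) ∂w) ^ (1 / q) ≤
        C * T * (A ^ (1 / q) + B ^ (1 / r - 1 / p)) * (∫⁻ x, g x ^ p ∂σ) ^ (1 / p) := by
  have hr0 : 0 < r := by linarith
  have hq0 : 0 < q := by linarith
  have hp0 : 0 < p := by linarith
  obtain ⟨D, hD, hmain⟩ := exists_testing_const ι X hL0 hL hp hpq hr0 hrq hα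
  refine ⟨(ENNReal.ofReal (q / r) * D) ^ (1 / r) * ENNReal.ofReal (p / (p - 1)),
    ENNReal.mul_ne_top (ENNReal.rpow_ne_top_of_nonneg (by positivity)
      (ENNReal.mul_ne_top ENNReal.ofReal_ne_top hD)) ENNReal.ofReal_ne_top, ?_⟩
  intro F K h hK σ w ν T A B g hg hgp hν hσ hw hpack hA hB hT
  have hgQ : ∀ Q ∈ F, ∫⁻ y in K Q, g y ∂σ ≠ ∞ := by
    intro Q hQ
    have h1 : ∀ x, g x ≤ 1 + g x ^ p := by
      intro x
      rcases le_total (g x) 1 with h | h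
      · exact h.trans le_self_add
      · calc g x = g x ^ (1 : ℝ) := (ENNReal.rpow_one _).symm
          _ ≤ g x ^ p := ENNReal.rpow_le_rpow_of_exponent_le h hp.le
          _ ≤ _ := le_add_self
    refine ne_top_of_le_ne_top ?_ (lintegral_mono h1)
    rw [lintegral_add_left measurable_const, setLIntegral_one]
    exact ENNReal.add_ne_top.2 ⟨(hσ Q hQ).2, ne_top_of_le_ne_top hgp (setLIntegral_le_lintegral _ _)⟩
  set G : ι → ℝ≥0∞ := fun Q => (∫⁻ y in K Q, g y ∂σ) / σ (K Q) with hG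
  set a : ι → ℝ≥0∞ := fun Q => (ν Q ^ (-α) * ∫⁻ y in K Q, g y ∂σ) ^ r with ha
  have hGσ : ∀ Q ∈ F, G Q * σ (K Q) = ∫⁻ y in K Q, g y ∂σ := fun Q hQ =>
    ENNReal.div_mul_cancel (hσ Q hQ).1 (hσ Q hQ).2
  have hmax := h.maximal_le hK (fun Q hQ => (hσ Q hQ).2) hg hp
    (fun Q hQ => ENNReal.div_ne_top (hgQ Q hQ) (hσ Q hQ).1) (fun Q hQ => (hGσ Q hQ).le)
  have hbound := h.sum_incr_sumRpow_le (G := G) (a := a) hr0 hrp hrq hpq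
    (fun Q hQ => ENNReal.rpow_ne_top_of_nonneg hr0.le (ENNReal.mul_ne_top
      (ENNReal.rpow_ne_top_of_ne_zero (hν Q hQ).1 (hν Q hQ).2) (hgQ Q hQ)))
    (fun Q hQ => (hw Q hQ).2) (c := fun Q => (ν Q ^ (-α) * σ (K Q)) ^ r * w (K Q))
    (D := D * T ^ r) (fun Q hQ => ?_)
    (fun R hR => ?_) hA hB
  rotate_left
  · simp only [ha]
    rw [← hGσ Q hQ, ENNReal.mul_rpow_of_nonneg _ _ hr0.le, ENNReal.mul_rpow_of_nonneg _ _ hr0.le,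
      ENNReal.mul_rpow_of_nonneg _ _ hr0.le]
    exact le_of_eq (by ring)
  · rw [mul_assoc]
    exact hmain F K h hK σ w ν T hν hσ hw hpack hT R hR
  have hs : 0 < q / r := by positivity
  rw [← h.sum_incr_mul_measure (sumRpow_mono a hs.le) (sumRpow_empty a hs) hK]
  have hr' : 0 ≤ 1 / r := by positivity
  calc _ = ((∑ R ∈ F, incr F K (sumRpow a (q / r)) R * w (K R)) ^ (r / q)) ^ (1 / r) := by
        rw [← ENNReal.rpow_mul]
        congr 1
        field_simp
    _ ≤ _ := ENNReal.rpow_le_rpow hbound hr'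
    _ = (ENNReal.ofReal (q / r) * D) ^ (1 / r) * T *
          (∑ R ∈ F, incr F K (supRpow G p) R * σ (K R)) ^ (1 / p) *
          (A ^ (r / q) + B ^ (1 - r / p)) ^ (1 / r) := by
        rw [← mul_assoc, ENNReal.mul_rpow_of_nonneg _ _ hr', ENNReal.mul_rpow_of_nonneg _ _ hr',
          ENNReal.mul_rpow_of_nonneg _ _ hr', ← ENNReal.rpow_mul T, ← ENNReal.rpow_mul (∑ R ∈ F, _),
          mul_one_div_cancel hr0.ne', ENNReal.rpow_one]
        congr 3
        field_simp
    _ ≤ (ENNReal.ofReal (q / r) * D) ^ (1 / r) * T *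
          (ENNReal.ofReal (p / (p - 1)) * (∫⁻ x, g x ^ p ∂σ) ^ (1 / p)) *
          (A ^ (1 / q) + B ^ (1 / r - 1 / p)) := by
        gcongr
        refine (ENNReal.rpow_add_le_add_rpow _ _ hr' (by rw [div_le_one hr0]; exact hr)).trans_eq ?_
        rw [← ENNReal.rpow_mul, ← ENNReal.rpow_mul]
        congr 2 <;> field_simp
    _ = _ := by ring

end Weighted

namespace Cube

variable {n : ℕ}

/-- The half-open version of a cube. -/
def halfOpen (Q : Cube n) : Set (Fin n → ℝ) :=
  Set.univ.pi fun i => Set.Ico (Q.corner i) (Q.corner i + Q.side)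

theorem mem_halfOpen {Q : Cube n} {x : Fin n → ℝ} :
    x ∈ Q.halfOpen ↔ ∀ i, Q.corner i ≤ x i ∧ x i < Q.corner i + Q.side := by
  simp [halfOpen]

theorem carrier_eq_pi (Q : Cube n) :
    Q.carrier = Set.univ.pi fun i => Set.Icc (Q.corner i) (Q.corner i + Q.side) := by
  ext x; simp only [carrier, mem_ofPred_eq, Set.mem_univ_pi, Set.mem_Icc]

theorem carrier_eq_Icc (Q : Cube n) :
    Q.carrier = Set.Icc Q.corner (fun i => Q.corner i + Q.side) := by
  rw [carrier_eq_pi, Set.pi_univ_Icc]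

theorem measurableSet_carrier (Q : Cube n) : MeasurableSet Q.carrier := by
  rw [carrier_eq_Icc]; exact measurableSet_Icc

theorem measurableSet_halfOpen (Q : Cube n) : MeasurableSet Q.halfOpen :=
  MeasurableSet.univ_pi fun _ => measurableSet_Ico

theorem halfOpen_nonempty (Q : Cube n) : Q.halfOpen.Nonempty :=
  ⟨Q.corner, mem_halfOpen.2 fun _ => ⟨le_rfl, lt_add_of_pos_right _ Q.side_pos⟩⟩

theorem halfOpen_ae_eq_carrier (Q : Cube n) : Q.halfOpen =ᵐ[volume] Q.carrier := by
  rw [carrier_eq_Icc]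
  exact Measure.univ_pi_Ico_ae_eq_Icc

theorem vol_pos (Q : Cube n) : 0 < Q.vol := pow_pos Q.side_pos n

theorem volume_carrier (Q : Cube n) : volume Q.carrier = ENNReal.ofReal Q.vol := by
  rw [carrier_eq_Icc, Real.volume_Icc_pi]
  simp [vol, ENNReal.ofReal_pow Q.side_pos.le]

theorem ofReal_vol_ne_zero (Q : Cube n) : ENNReal.ofReal Q.vol ≠ 0 :=
  (ENNReal.ofReal_pos.2 Q.vol_pos).ne'

theorem closure_halfOpen (Q : Cube n) : closure Q.halfOpen = Q.carrier := by
  rw [halfOpen, closure_pi_set, carrier_eq_pi]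
  congr 1
  funext i
  exact closure_Ico (by linarith [Q.side_pos])

theorem carrier_subset_of_halfOpen_subset {Q R : Cube n} (h : Q.halfOpen ⊆ R.halfOpen) :
    Q.carrier ⊆ R.carrier := by
  rw [← closure_halfOpen, ← closure_halfOpen]
  exact closure_mono h

theorem halfOpen_injective (hn : 1 ≤ n) : Function.Injective (halfOpen (n := n)) := by
  intro Q R h
  have hc : Q.carrier = R.carrier :=
    (carrier_subset_of_halfOpen_subset h.le).antisymm (carrier_subset_of_halfOpen_subset h.ge)
  rw [carrier_eq_Icc, carrier_eq_Icc, Set.Icc_eq_Icc_iff fun i => by linarith [Q.side_pos]] at hc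
  have h1 := congrFun hc.2 ⟨0, hn⟩
  obtain ⟨c, s, hs⟩ := Q
  obtain ⟨c', s', hs'⟩ := R
  obtain ⟨rfl, -⟩ := hc
  obtain rfl : s = s' := by simpa using h1
  rfl

theorem halfOpen_subset_or_disjoint {Q R : Cube n} {s : ℝ} (hs : 0 < s) (N : ℕ) {m l : Fin n → ℤ}
    (hQ : Q.side = s) (hQc : ∀ i, Q.corner i = m i * s) (hR : R.side = N * s)
    (hRc : ∀ i, R.corner i = l i * (N * s)) :
    Q.halfOpen ⊆ R.halfOpen ∨ Disjoint Q.halfOpen R.halfOpen := by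
  refine or_iff_not_imp_right.2 fun hd => ?_
  obtain ⟨x, hxQ, hxR⟩ := Set.not_disjoint_iff.1 hd
  intro y hy
  rw [mem_halfOpen] at *
  intro i
  have h1 := hxQ i
  have h2 := hxR i
  have h3 := hy i
  rw [hQ, hQc] at h1 h3
  rw [hR, hRc] at h2 ⊢
  have h4 : l i * (N : ℤ) < m i + 1 := by
    have : (l i * N : ℝ) * s < (m i + 1) * s := by nlinarith
    exact_mod_cast lt_of_mul_lt_mul_right this hs.le
  have h5 : m i < (l i + 1) * (N : ℤ) := by
    have : (m i : ℝ) * s < ((l i + 1) * N) * s := by nlinarith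
    exact_mod_cast lt_of_mul_lt_mul_right this hs.le
  have h6 : (l i * N : ℝ) ≤ m i := by exact_mod_cast Int.lt_add_one_iff.1 h4
  have h7 : (m i + 1 : ℝ) ≤ (l i + 1) * N := by exact_mod_cast h5
  have h8 := mul_le_mul_of_nonneg_right h6 hs.le
  have h9 := mul_le_mul_of_nonneg_right h7 hs.le
  constructor <;> nlinarith

theorem IsDyadic.halfOpen_nested {Q R : Cube n} (hQ : Q.IsDyadic) (hR : R.IsDyadic) :
    Q.halfOpen ⊆ R.halfOpen ∨ R.halfOpen ⊆ Q.halfOpen ∨ Disjoint Q.halfOpen R.halfOpen := by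
  obtain ⟨j, m, hj, hm⟩ := hQ
  obtain ⟨k, l, hk, hl⟩ := hR
  have key : ∀ {a b : ℤ}, b ≤ a → (2 : ℝ) ^ (-b) = ((2 ^ (a - b).toNat : ℕ) : ℝ) * 2 ^ (-a) := by
    intro a b hab
    have : ((a - b).toNat : ℤ) = a - b := Int.toNat_of_nonneg (by omega)
    push_cast
    rw [← zpow_natCast, this, ← zpow_add₀ two_ne_zero]
    congr 1
    ring
  rcases le_total k j with h | h
  · rw [key h] at hk
    simp_rw [key h] at hl
    rcases halfOpen_subset_or_disjoint (by positivity) _ hj hm hk hl with h | h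
    exacts [Or.inl h, Or.inr (Or.inr h)]
  · rw [key h] at hj
    simp_rw [key h] at hm
    rcases halfOpen_subset_or_disjoint (by positivity) _ hk hl hj hm with h | h
    exacts [Or.inr (Or.inl h), Or.inr (Or.inr h.symm)]

theorem laminar_halfOpen (hn : 1 ≤ n) {F : Finset (Cube n)} (hF : ∀ Q ∈ F, Q.IsDyadic) :
    Laminar F halfOpen :=
  ⟨fun Q hQ R hR => (hF Q hQ).halfOpen_nested (hF R hR), (halfOpen_injective hn).injOn,
    fun Q _ => Q.halfOpen_nonempty⟩

theorem countable_isDyadic : {Q : Cube n | Q.IsDyadic}.Countable := by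
  refine (Set.countable_range fun jm : ℤ × (Fin n → ℤ) =>
    (⟨fun i => (jm.2 i : ℝ) * (2 : ℝ) ^ (-jm.1), (2 : ℝ) ^ (-jm.1), by positivity⟩ : Cube n)).mono ?_
  rintro ⟨c, s, hs⟩ ⟨j, m, hj, hm⟩
  refine ⟨(j, m), ?_⟩
  have hc : c = fun i => (m i : ℝ) * (2 : ℝ) ^ (-j) := funext hm
  simp only at hj
  subst hj hc
  rfl

/-- The cube `[-N-1, N+1]ⁿ`. -/
def centered (n N : ℕ) : Cube n := ⟨fun _ => -(N + 1), 2 * (N + 1), by positivity⟩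

theorem exists_forall_mem_centered (x : Fin n → ℝ) : ∃ N, ∀ M ≥ N, x ∈ (centered n M).carrier := by
  obtain ⟨N, hN⟩ := exists_nat_ge ‖x‖
  refine ⟨N, fun M hM i => ?_⟩
  have h1 := abs_le.1 ((Real.norm_eq_abs _).symm.trans_le (norm_le_pi_norm x i))
  have h2 : (N : ℝ) ≤ M := by exact_mod_cast hM
  simp only [centered]
  constructor <;> linarith [h1.1, h1.2]

end Cube

section Sparse

variable {n : ℕ} {η : ℝ}

theorem IsSparse.sum_vol_mul_le {S : Set (Cube n)} (hS : IsSparse η S) (hη : 0 < η)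
    {G : Finset (Cube n)} {R : Cube n} (hG : ∀ Q ∈ G, Q ∈ S ∧ Q.carrier ⊆ R.carrier)
    {c : Cube n → ℝ≥0∞} {M : (Fin n → ℝ) → ℝ≥0∞} (hc : ∀ Q ∈ G, ∀ x ∈ Q.carrier, c Q ≤ M x) :
    ∑ Q ∈ G, ENNReal.ofReal Q.vol * c Q ≤ ENNReal.ofReal (1 / η) * ∫⁻ x in R.carrier, M x := by
  obtain ⟨E, hEm, hEQ, hEd, hEv⟩ := hS
  calc ∑ Q ∈ G, ENNReal.ofReal Q.vol * c Q
      ≤ ∑ Q ∈ G, ENNReal.ofReal (1 / η) * ∫⁻ x in E Q, M x := by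
        refine Finset.sum_le_sum fun Q hQ => ?_
        have h1 : ENNReal.ofReal Q.vol ≤ ENNReal.ofReal (1 / η) * volume (E Q) := by
          calc ENNReal.ofReal Q.vol = ENNReal.ofReal (1 / η) * ENNReal.ofReal (η * Q.vol) := by
                rw [← ENNReal.ofReal_mul (by positivity)]
                congr 1
                field_simp
            _ ≤ _ := by gcongr; exact hEv Q (hG Q hQ).1
        calc _ ≤ ENNReal.ofReal (1 / η) * volume (E Q) * c Q := by gcongr
          _ = ENNReal.ofReal (1 / η) * ∫⁻ _ in E Q, c Q := by rw [setLIntegral_const]; ring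
          _ ≤ _ := by
            gcongr ENNReal.ofReal (1 / η) * ?_
            exact setLIntegral_mono' (hEm Q (hG Q hQ).1) fun x hx =>
              hc Q hQ x (hEQ Q (hG Q hQ).1 hx)
    _ = ENNReal.ofReal (1 / η) * ∫⁻ x in ⋃ Q ∈ G, E Q, M x := by
        rw [← Finset.mul_sum, lintegral_biUnion_finset]
        · exact fun Q hQ R hR hQR => hEd (hG Q hQ).1 (hG R hR).1 hQR
        · exact fun Q hQ => hEm Q (hG Q hQ).1
    _ ≤ _ := by
        gcongr
        exact Set.iUnion₂_subset fun Q hQ => (hEQ Q (hG Q hQ).1).trans (hG Q hQ).2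

theorem IsSparse.sum_vol_le {S : Set (Cube n)} (hS : IsSparse η S) (hη : 0 < η)
    {G : Finset (Cube n)} {R : Cube n} (hG : ∀ Q ∈ G, Q ∈ S ∧ Q.carrier ⊆ R.carrier) :
    ∑ Q ∈ G, ENNReal.ofReal Q.vol ≤ ENNReal.ofReal (1 / η) * ENNReal.ofReal R.vol := by
  simpa [R.volume_carrier] using
    hS.sum_vol_mul_le hη hG (c := fun _ => 1) (M := fun _ => 1) fun _ _ _ _ => le_rfl

theorem IsSparse.sum_wMass_le {S : Set (Cube n)} (hS : IsSparse η S) (hη : 0 < η)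
    {G : Finset (Cube n)} {R : Cube n} (hG : ∀ Q ∈ G, Q ∈ S ∧ Q.carrier ⊆ R.carrier)
    {w : (Fin n → ℝ) → ℝ} (hw : ∀ x, 0 ≤ w x) (h0 : wMass w R ≠ 0) (h1 : wMass w R ≠ ∞) :
    ∑ Q ∈ G, wMass w Q ≤ ENNReal.ofReal (1 / η) * AinfChar w * wMass w R := by
  have hc : ∀ Q ∈ G, ∀ x ∈ Q.carrier,
      (ENNReal.ofReal Q.vol)⁻¹ * wMass w Q ≤ maximal (R.carrier.indicator w) x := by
    intro Q hQ x hx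
    refine le_of_eq_of_le ?_ (le_iSup₂ (α := ℝ≥0∞) Q hx)
    rw [wMass]
    congr 1
    refine setLIntegral_congr_fun Q.measurableSet_carrier fun y hy => ?_
    simp [Set.indicator_of_mem ((hG Q hQ).2 hy), abs_of_nonneg (hw y)]
  calc ∑ Q ∈ G, wMass w Q
      = ∑ Q ∈ G, ENNReal.ofReal Q.vol * ((ENNReal.ofReal Q.vol)⁻¹ * wMass w Q) := by
        refine Finset.sum_congr rfl fun Q _ => ?_
        rw [← mul_assoc, ENNReal.mul_inv_cancel Q.ofReal_vol_ne_zero ENNReal.ofReal_ne_top, one_mul]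
    _ ≤ _ := hS.sum_vol_mul_le hη hG hc
    _ = ENNReal.ofReal (1 / η) * ((wMass w R)⁻¹ *
          ∫⁻ x in R.carrier, maximal (R.carrier.indicator w) x) * wMass w R := by
        rw [mul_assoc, mul_right_comm, ENNReal.inv_mul_cancel h0 h1, one_mul]
    _ ≤ _ := by
        gcongr
        exact le_iSup (fun Q : Cube n => (wMass w Q)⁻¹ *
          ∫⁻ x in Q.carrier, maximal (Q.carrier.indicator w) x) R

end Sparse

section Characteristic

variable {n : ℕ} {p q : ℝ} {ω : (Fin n → ℝ) → ℝ}

theorem withDensity_halfOpen (w : (Fin n → ℝ) → ℝ) (Q : Cube n) :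
    volume.withDensity (fun x => ENNReal.ofReal (w x)) Q.halfOpen = wMass w Q := by
  rw [withDensity_apply _ Q.measurableSet_halfOpen, wMass,
    Measure.restrict_congr_set Q.halfOpen_ae_eq_carrier]

theorem mul_le_ApqChar (hω : ∀ x, 0 ≤ ω x) (hq : 0 ≤ q) (Q : Cube n) :
    ((ENNReal.ofReal Q.vol)⁻¹ * wMass (fun x => ω x ^ q) Q) *
      ((ENNReal.ofReal Q.vol)⁻¹ *
        ∫⁻ x in Q.carrier, ENNReal.ofReal (ω x) ^ (-(p / (p - 1)))) ^ (q / (p / (p - 1))) ≤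
      ApqChar p q ω := by
  have e : wMass (fun x => ω x ^ q) Q = ∫⁻ x in Q.carrier, ENNReal.ofReal (ω x) ^ q := by
    simp_rw [wMass, ENNReal.ofReal_rpow_of_nonneg (hω _) hq]
  rw [e]
  exact le_iSup (fun Q : Cube n =>
    ((ENNReal.ofReal Q.vol)⁻¹ * ∫⁻ x in Q.carrier, (ENNReal.ofReal (ω x)) ^ q) *
      ((ENNReal.ofReal Q.vol)⁻¹ *
          ∫⁻ x in Q.carrier, (ENNReal.ofReal (ω x)) ^ (-(p / (p - 1)))) ^ (q / (p / (p - 1)))) Q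

theorem wMass_rpow_eq_zero_iff (hω : ∀ x, 0 ≤ ω x) (hωm : AEMeasurable ω) {s : ℝ} (hs : 0 < s)
    (Q : Cube n) : wMass (fun x => ω x ^ s) Q = 0 ↔ ∀ᵐ x ∂volume.restrict Q.carrier, ω x = 0 := by
  rw [wMass, lintegral_eq_zero_iff' (hωm.restrict.pow_const _).ennreal_ofReal]
  refine Filter.eventually_congr (Filter.Eventually.of_forall fun x => ?_)
  simp only [Pi.zero_apply, ENNReal.ofReal_eq_zero]
  constructor
  · intro h
    by_contra h0
    exact absurd (Real.rpow_pos_of_pos (lt_of_le_of_ne (hω x) (Ne.symm h0)) s) h.not_gt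
  · intro h
    simp [h, Real.zero_rpow hs.ne']

theorem setLIntegral_neg_rpow_ne_top (hω : ∀ x, 0 ≤ ω x) (hp : 1 < p) (hq : 0 < q)
    (hA : ApqChar p q ω < ∞) {Q : Cube n} (h0 : wMass (fun x => ω x ^ q) Q ≠ 0) :
    ∫⁻ x in Q.carrier, ENNReal.ofReal (ω x) ^ (-(p / (p - 1))) ≠ ∞ := by
  intro htop
  have hp1 : 0 < p - 1 := by linarith
  have h := (mul_le_ApqChar (p := p) hω hq.le Q).trans_lt hA
  have hv : (ENNReal.ofReal Q.vol)⁻¹ ≠ 0 := ENNReal.inv_ne_zero.2 ENNReal.ofReal_ne_top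
  rw [htop, ENNReal.mul_top hv, ENNReal.top_rpow_of_pos (by positivity),
    ENNReal.mul_top (mul_ne_zero hv h0)] at h
  exact lt_irrefl _ h

theorem ae_pos_of_ApqChar_lt_top (hω : ∀ x, 0 ≤ ω x) (hωm : AEMeasurable ω) (hp : 1 < p)
    (hq : 0 < q) (hA : ApqChar p q ω < ∞) (hne : ¬ ∀ᵐ x, ω x = 0) : ∀ᵐ x, 0 < ω x := by
  have hp1 : 0 < p - 1 := by linarith
  have hmono : ∀ {N M : ℕ}, N ≤ M →
      (Cube.centered n N).carrier ⊆ (Cube.centered n M).carrier := by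
    intro N M hNM x hx i
    have h2 : (N : ℝ) ≤ M := by exact_mod_cast hNM
    have h3 := hx i
    simp only [Cube.centered] at h3 ⊢
    constructor <;> linarith [h3.1, h3.2]
  obtain ⟨N, hN⟩ : ∃ N, ¬ ∀ᵐ x ∂volume.restrict (Cube.centered n N).carrier, ω x = 0 := by
    by_contra! hcon
    refine hne ?_
    simp_rw [ae_restrict_iff' (Cube.measurableSet_carrier _)] at hcon
    filter_upwards [ae_all_iff.2 hcon] with x hx
    obtain ⟨N, hN⟩ := Cube.exists_forall_mem_centered x
    exact hx N (hN N le_rfl)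
  have hpos : ∀ M ≥ N, ∀ᵐ x, x ∈ (Cube.centered n M).carrier → 0 < ω x := by
    intro M hM
    rw [← ae_restrict_iff' (Cube.measurableSet_carrier _)]
    have h0 : wMass (fun x => ω x ^ q) (Cube.centered n M) ≠ 0 := by
      rw [Ne, wMass_rpow_eq_zero_iff hω hωm hq]
      exact fun h => hN (ae_mono (Measure.restrict_mono (hmono hM) le_rfl) h)
    have h1 := setLIntegral_neg_rpow_ne_top hω hp hq hA h0
    filter_upwards [ae_lt_top' (hωm.restrict.ennreal_ofReal.pow_const _) h1] with x hx
    refine lt_of_le_of_ne (hω x) fun h => ?_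
    rw [← h, ENNReal.ofReal_zero, ENNReal.zero_rpow_of_neg (neg_lt_zero.2 (by positivity))] at hx
    exact lt_irrefl _ hx
  have hpos' : ∀ᵐ x, ∀ M, N ≤ M → x ∈ (Cube.centered n M).carrier → 0 < ω x :=
    ae_all_iff.2 fun M => Filter.eventually_imp_distrib_left.2 (hpos M)
  filter_upwards [hpos'] with x hx
  obtain ⟨N', hN'⟩ := Cube.exists_forall_mem_centered x
  exact hx (max N N') (le_max_left _ _) (hN' _ (le_max_right _ _))

theorem wMass_neg_rpow_eq (hpos : ∀ᵐ x, 0 < ω x) (s : ℝ) (Q : Cube n) :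
    wMass (fun x => ω x ^ s) Q = ∫⁻ x in Q.carrier, ENNReal.ofReal (ω x) ^ s := by
  refine lintegral_congr_ae (ae_restrict_of_ae ?_)
  filter_upwards [hpos] with x hx
  exact (ENNReal.ofReal_rpow_of_pos hx).symm

theorem wMass_ne_zero (hpos : ∀ᵐ x, 0 < ω x) (hωm : AEMeasurable ω) (s : ℝ) (Q : Cube n) :
    wMass (fun x => ω x ^ s) Q ≠ 0 := by
  rw [wMass, Ne, lintegral_eq_zero_iff' (hωm.restrict.pow_const _).ennreal_ofReal]
  intro h
  have h2 : ∀ᵐ x ∂volume.restrict Q.carrier, False := by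
    filter_upwards [h, ae_restrict_of_ae hpos] with x hx hx'
    simp only [Pi.zero_apply, ENNReal.ofReal_eq_zero] at hx
    exact absurd (Real.rpow_pos_of_pos hx' s) hx.not_gt
  rw [Filter.eventually_false_iff_eq_bot, ae_eq_bot, Measure.restrict_eq_zero,
    Q.volume_carrier] at h2
  exact Q.ofReal_vol_ne_zero h2

theorem wMass_dual_ne_top (hω : ∀ x, 0 ≤ ω x) (hpos : ∀ᵐ x, 0 < ω x) (hωm : AEMeasurable ω)
    (hp : 1 < p) (hq : 0 < q) (hA : ApqChar p q ω < ∞) (Q : Cube n) :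
    wMass (fun x => ω x ^ (-(p / (p - 1)))) Q ≠ ∞ := by
  rw [wMass_neg_rpow_eq hpos]
  exact setLIntegral_neg_rpow_ne_top hω hp hq hA (wMass_ne_zero hpos hωm q Q)

theorem wMass_ne_top (hω : ∀ x, 0 ≤ ω x) (hpos : ∀ᵐ x, 0 < ω x) (hωm : AEMeasurable ω)
    (hp : 1 < p) (hq : 0 < q) (hA : ApqChar p q ω < ∞) (Q : Cube n) :
    wMass (fun x => ω x ^ q) Q ≠ ∞ := by
  intro htop
  have hp1 : 0 < p - 1 := by linarith
  have h := (mul_le_ApqChar (p := p) hω hq.le Q).trans_lt hA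
  have hv : (ENNReal.ofReal Q.vol)⁻¹ ≠ 0 := ENNReal.inv_ne_zero.2 ENNReal.ofReal_ne_top
  rw [← wMass_neg_rpow_eq hpos, htop, ENNReal.mul_top hv, ENNReal.top_mul] at h
  · exact lt_irrefl _ h
  · rw [Ne, ENNReal.rpow_eq_zero_iff_of_pos (by positivity)]
    exact mul_ne_zero hv (wMass_ne_zero hpos hωm _ Q)

theorem two_weight_le_ApqChar (hω : ∀ x, 0 ≤ ω x) (hpos : ∀ᵐ x, 0 < ω x) (hωm : AEMeasurable ω)
    (hp : 1 < p) (hq : 0 < q) (hA : ApqChar p q ω < ∞) {α : ℝ} (hα : 1 / q + (1 - 1 / p) = α)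
    (Q : Cube n) :
    ENNReal.ofReal Q.vol ^ (-α) * wMass (fun x => ω x ^ q) Q ^ (1 / q) *
      wMass (fun x => ω x ^ (-(p / (p - 1)))) Q ^ (1 - 1 / p) ≤ ApqChar p q ω ^ (1 / q) := by
  have hp1 : p - 1 ≠ 0 := by linarith
  have hp0 : p ≠ 0 := by linarith
  refine le_of_eq_of_le ?_
    (ENNReal.rpow_le_rpow (mul_le_ApqChar (p := p) hω hq.le Q) (by positivity : 0 ≤ 1 / q))
  rw [← wMass_neg_rpow_eq hpos]
  obtain ⟨a, ha⟩ := exists_eq_ofReal_exp Q.ofReal_vol_ne_zero ENNReal.ofReal_ne_top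
  obtain ⟨b, hb⟩ := exists_eq_ofReal_exp (wMass_ne_zero hpos hωm q Q)
    (wMass_ne_top hω hpos hωm hp hq hA Q)
  obtain ⟨c, hc⟩ := exists_eq_ofReal_exp (wMass_ne_zero hpos hωm (-(p / (p - 1))) Q)
    (wMass_dual_ne_top hω hpos hωm hp hq hA Q)
  rw [ha, hb, hc, ← ENNReal.rpow_neg_one]
  simp only [ofReal_exp_rpow, ofReal_exp_mul]
  congr 2
  rw [← hα]
  field_simp
  ring

end Characteristic

theorem sum_rpow_le_rpow_sum {ι : Type*} (s : Finset ι) (f : ι → ℝ≥0∞) {m : ℝ} (hm : 1 ≤ m) :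
    ∑ i ∈ s, f i ^ m ≤ (∑ i ∈ s, f i) ^ m := by
  classical
  induction s using Finset.induction_on with
  | empty => simp
  | insert i s hi ih =>
    rw [Finset.sum_insert hi, Finset.sum_insert hi]
    exact (add_le_add_right ih _).trans (ENNReal.add_rpow_le_rpow_add _ _ hm)

section Reduction

variable {n : ℕ} {q : ℝ}

theorem eNorm_eq_lintegral_withDensity {u : (Fin n → ℝ) → ℝ} (hu : AEMeasurable u) (s : ℝ)
    (g : (Fin n → ℝ) → ℝ≥0∞) :
    eNorm s u g =
      (∫⁻ x, g x ^ s ∂volume.withDensity fun x => ENNReal.ofReal (u x)) ^ (1 / s) := by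
  rw [eNorm, lintegral_withDensity_eq_lintegral_mul_non_measurable₀ _ hu.ennreal_ofReal
    (Filter.Eventually.of_forall fun _ => ENNReal.ofReal_lt_top)]
  simp only [Pi.mul_apply, mul_comm]

/-- The sparse operator is the supremum over its finite subcollections. -/
theorem eNorm_sparseOp_le {S : Set (Cube n)} (hS : S.Countable) {r α : ℝ} (hr : 0 < r)
    (hq : 0 < q) {u : (Fin n → ℝ) → ℝ} (hu : AEMeasurable u) (f : (Fin n → ℝ) → ℝ) {C : ℝ≥0∞}
    (h : ∀ F : Finset (Cube n), (∀ Q ∈ F, Q ∈ S) →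
      (∫⁻ x, (∑ Q ∈ F, Q.carrier.indicator (fun _ =>
          ((ENNReal.ofReal Q.vol) ^ (-α) * ∫⁻ y in Q.carrier, ENNReal.ofReal (f y)) ^ r) x) ^ (q / r)
        ∂volume.withDensity fun x => ENNReal.ofReal (u x)) ^ (1 / q) ≤ C) :
    eNorm q u (sparseOp S r α f) ≤ C := by
  classical
  have := hS.to_subtype
  have hqr : 0 < q / r := by positivity
  have hq1 : 0 < 1 / q := by positivity
  set b : Cube n → (Fin n → ℝ) → ℝ≥0∞ := fun Q => Q.carrier.indicator (fun _ =>
    ((ENNReal.ofReal Q.vol) ^ (-α) * ∫⁻ y in Q.carrier, ENNReal.ofReal (f y)) ^ r) with hb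
  have hbm : ∀ Q, Measurable (b Q) := fun Q => measurable_const.indicator Q.measurableSet_carrier
  have e : ∀ x, sparseOp S r α f x ^ q = ⨆ F : Finset S, (∑ Q ∈ F, b Q.1 x) ^ (q / r) := by
    intro x
    rw [sparseOp, cubeSum, ← ENNReal.rpow_mul, one_div_mul_eq_div, ENNReal.tsum_eq_iSup_sum]
    exact (ENNReal.orderIsoRpow (q / r) hqr).map_iSup _
  rw [eNorm_eq_lintegral_withDensity hu]
  simp_rw [e]
  rw [lintegral_iSup_directed]
  · rw [← ENNReal.orderIsoRpow_apply (1 / q) hq1, OrderIso.map_iSup]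
    refine iSup_le fun F => ?_
    have h1 := h (F.map (Function.Embedding.subtype _)) fun Q hQ => by
      obtain ⟨Q', _, rfl⟩ := Finset.mem_map.1 hQ
      exact Q'.2
    simpa only [Finset.sum_map, Function.Embedding.coe_subtype, ENNReal.orderIsoRpow_apply] using h1
  · exact fun F => ((Finset.measurable_sum _ fun Q _ => hbm Q.1).pow_const _).aemeasurable
  · refine Monotone.directed_le fun F G hFG x => ?_
    exact ENNReal.rpow_le_rpow (Finset.sum_le_sum_of_subset hFG) hqr.le

theorem lintegral_sum_indicator_le {F : Finset (Cube n)} {r : ℝ} (hr : 0 < r) (hr2 : r ≤ 2)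
    (hq : 0 < q) {μ : Measure (Fin n → ℝ)} (hμ : μ ≪ volume) (d : Cube n → ℝ≥0∞) :
    ∫⁻ x, (∑ Q ∈ F, Q.carrier.indicator (fun _ => d Q ^ (2 : ℝ)) x) ^ (q / 2) ∂μ ≤
      ∫⁻ x, sumRpow (fun Q => d Q ^ r) (q / r) (above F Cube.halfOpen {x}) ∂μ := by
  classical
  have hae : ∀ᵐ x ∂μ, ∀ Q ∈ F, (x ∈ Q.halfOpen ↔ x ∈ Q.carrier) :=
    hμ.ae_le ((Finset.eventually_all F).2 fun Q _ => Q.halfOpen_ae_eq_carrier.mem_iff)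
  refine lintegral_mono_ae ?_
  filter_upwards [hae] with x hx
  have e : ∑ Q ∈ F, Q.carrier.indicator (fun _ => d Q ^ (2 : ℝ)) x =
      ∑ Q ∈ above F Cube.halfOpen {x}, (d Q ^ r) ^ (2 / r) := by
    rw [above, Finset.sum_filter]
    refine Finset.sum_congr rfl fun Q hQ => ?_
    rw [← ENNReal.rpow_mul, mul_div_cancel₀ _ hr.ne']
    by_cases h : x ∈ Q.carrier <;> simp [h, hx Q hQ]
  rw [e, sumRpow]
  calc _ ≤ ((∑ Q ∈ above F Cube.halfOpen {x}, d Q ^ r) ^ (2 / r)) ^ (q / 2) := by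
        gcongr
        exact sum_rpow_le_rpow_sum _ _ (by rw [one_le_div hr]; exact hr2)
    _ = _ := by
        rw [← ENNReal.rpow_mul]
        congr 1
        field_simp

end Reduction

section Weight

variable {n : ℕ} {p : ℝ} {ω f : (Fin n → ℝ) → ℝ}

theorem setLIntegral_div_withDensity {v : (Fin n → ℝ) → ℝ} (hv : AEMeasurable v)
    (hpos : ∀ᵐ x, 0 < v x) (Q : Cube n) :
    ∫⁻ x in Q.halfOpen, ENNReal.ofReal (f x) / ENNReal.ofReal (v x)
        ∂volume.withDensity (fun x => ENNReal.ofReal (v x)) =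
      ∫⁻ x in Q.carrier, ENNReal.ofReal (f x) := by
  rw [restrict_withDensity Q.measurableSet_halfOpen,
    lintegral_withDensity_eq_lintegral_mul_non_measurable₀ _ hv.restrict.ennreal_ofReal
      (Filter.Eventually.of_forall fun _ => ENNReal.ofReal_lt_top),
    Measure.restrict_congr_set Q.halfOpen_ae_eq_carrier]
  refine lintegral_congr_ae (ae_restrict_of_ae ?_)
  filter_upwards [hpos] with x hx
  exact ENNReal.mul_div_cancel (ENNReal.ofReal_pos.2 hx).ne' ENNReal.ofReal_ne_top

theorem lintegral_div_rpow_le (hωm : AEMeasurable ω) (hpos : ∀ᵐ x, 0 < ω x) (hp : 1 < p) :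
    ∫⁻ x, (ENNReal.ofReal (f x) / ENNReal.ofReal (ω x ^ (-(p / (p - 1))))) ^ p
        ∂volume.withDensity (fun x => ENNReal.ofReal (ω x ^ (-(p / (p - 1))))) ≤
      ∫⁻ x, ENNReal.ofReal (|f x| ^ p) * ENNReal.ofReal (ω x ^ p) := by
  have hp0 : 0 < p := by linarith
  have hp1 : p - 1 ≠ 0 := by linarith
  rw [lintegral_withDensity_eq_lintegral_mul_non_measurable₀ _ (hωm.pow_const _).ennreal_ofReal
    (Filter.Eventually.of_forall fun _ => ENNReal.ofReal_lt_top)]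
  refine lintegral_mono_ae ?_
  filter_upwards [hpos] with x hx
  have e : ENNReal.ofReal (ω x ^ (-(p / (p - 1)))) *
      (ENNReal.ofReal (ω x ^ (-(p / (p - 1)))))⁻¹ ^ p = ENNReal.ofReal (ω x ^ p) := by
    obtain ⟨a, ha⟩ : ∃ a, ω x = Real.exp a := ⟨Real.log (ω x), (Real.exp_log hx).symm⟩
    rw [ha, ← ENNReal.rpow_neg_one, ← Real.exp_mul, ← Real.exp_mul]
    simp only [ofReal_exp_rpow, ofReal_exp_mul]
    congr 2
    field_simp
    ring
  simp only [Pi.mul_apply]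
  rw [div_eq_mul_inv (ENNReal.ofReal (f x)), ENNReal.mul_rpow_of_nonneg _ _ hp0.le, mul_left_comm, e]
  gcongr
  rw [← ENNReal.ofReal_rpow_of_nonneg (abs_nonneg _) hp0.le]
  gcongr
  exact le_abs_self _

end Weight

theorem exists_eNorm_sparseOp_le {n : ℕ} (hn : 1 ≤ n) {p q α η : ℝ} (hα1 : α < 1) (hp : 1 < p)
    (hpq : p ≤ q) (hscale : 1 / q + (1 - 1 / p) = α) (hη : 0 < η) :
    ∃ C : ℝ≥0∞, C ≠ ∞ ∧
      ∀ S : Set (Cube n), (∀ Q ∈ S, Q.IsDyadic) → IsSparse η S →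
      ∀ ω : (Fin n → ℝ) → ℝ, (∀ x, 0 ≤ ω x) → AEMeasurable ω → (∀ᵐ x, 0 < ω x) →
        ApqChar p q ω < ∞ →
      ∀ f : (Fin n → ℝ) → ℝ, Measurable f → wNorm p (fun x => ω x ^ p) f < ∞ →
        eNorm q (fun x => ω x ^ q) (sparseOp S 2 α f) ≤
          C * ApqChar p q ω ^ (1 / q) *
            ((ENNReal.ofReal (1 / η) * AinfChar (fun x => ω x ^ (-(p / (p - 1))))) ^ (1 / q) +
              (ENNReal.ofReal (1 / η) * AinfChar (fun x => ω x ^ q)) ^ max (1 / 2 - 1 / p) 0) *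
            wNorm p (fun x => ω x ^ p) f := by
  have hp0 : 0 < p := by linarith
  have hq0 : 0 < q := by linarith
  have hpq' : p < q := by
    refine lt_of_le_of_ne hpq ?_
    rintro rfl
    linarith
  set r : ℝ := min 2 p with hr
  have hr1 : 1 ≤ r := le_min (by norm_num) hp.le
  have hr0 : 0 < r := by linarith
  have hrp : r ≤ p := min_le_right _ _
  have hr2 : r ≤ 2 := min_le_left _ _
  have hexp : 1 / r - 1 / p = max (1 / 2 - 1 / p) 0 := by
    rcases le_total 2 p with h | h
    · have : 1 / p ≤ 1 / 2 := one_div_le_one_div_of_le two_pos h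
      rw [hr, min_eq_left h, max_eq_left (by linarith)]
    · have : 1 / 2 ≤ 1 / p := one_div_le_one_div_of_le hp0 h
      rw [hr, min_eq_right h, max_eq_right (by linarith), sub_self]
  have hL0 : ENNReal.ofReal (1 / η) ≠ 0 := (ENNReal.ofReal_pos.2 (by positivity)).ne'
  obtain ⟨C, hC, hmain⟩ := exists_weighted_const (Cube n) (Fin n → ℝ) hL0 ENNReal.ofReal_ne_top hp hpq hr1 hrp
    (hrp.trans_lt hpq') hscale
  refine ⟨C, hC, fun S hSd hS ω hω hωm hpos hA f hf hfin => ?_⟩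
  set v : (Fin n → ℝ) → ℝ := fun x => ω x ^ (-(p / (p - 1))) with hv
  set u : (Fin n → ℝ) → ℝ := fun x => ω x ^ q with hu
  have hvm : AEMeasurable v := hωm.pow_const _
  have hum : AEMeasurable u := hωm.pow_const _
  have hvpos : ∀ᵐ x, 0 < v x := by
    filter_upwards [hpos] with x hx using Real.rpow_pos_of_pos hx _
  set σ : Measure (Fin n → ℝ) := volume.withDensity (fun x => ENNReal.ofReal (v x)) with hσ
  set w : Measure (Fin n → ℝ) := volume.withDensity (fun x => ENNReal.ofReal (u x)) with hw
  set g : (Fin n → ℝ) → ℝ≥0∞ := fun x => ENNReal.ofReal (f x) / ENNReal.ofReal (v x) with hg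
  have hgm : AEMeasurable g σ :=
    (hf.aemeasurable.ennreal_ofReal.div hvm.ennreal_ofReal).mono_ac
      (withDensity_absolutelyContinuous _ _)
  have hgp : ∫⁻ x, g x ^ p ∂σ ≤ ∫⁻ x, ENNReal.ofReal (|f x| ^ p) * ENNReal.ofReal (ω x ^ p) :=
    lintegral_div_rpow_le hωm hpos hp
  have hgtop : ∫⁻ x, g x ^ p ∂σ ≠ ∞ := by
    refine ne_top_of_le_ne_top (fun h => ?_) hgp
    rw [wNorm, h, ENNReal.top_rpow_of_pos (by positivity)] at hfin
    exact lt_irrefl _ hfin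
  have hσQ : ∀ Q : Cube n, σ Q.halfOpen = wMass v Q := withDensity_halfOpen v
  have hwQ : ∀ Q : Cube n, w Q.halfOpen = wMass u Q := withDensity_halfOpen u
  have hv0 : ∀ Q : Cube n, wMass v Q ≠ 0 := wMass_ne_zero hpos hωm _
  have hv1 : ∀ Q : Cube n, wMass v Q ≠ ∞ := wMass_dual_ne_top hω hpos hωm hp hq0 hA
  have hu0 : ∀ Q : Cube n, wMass u Q ≠ 0 := wMass_ne_zero hpos hωm _
  have hu1 : ∀ Q : Cube n, wMass u Q ≠ ∞ := wMass_ne_top hω hpos hωm hp hq0 hA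
  refine eNorm_sparseOp_le (Cube.countable_isDyadic.mono hSd) two_pos hq0 hum f fun F hF => ?_
  classical
  have hsub : ∀ R : Cube n, ∀ Q ∈ F.filter (fun Q => Q.halfOpen ⊆ R.halfOpen),
      Q ∈ S ∧ Q.carrier ⊆ R.carrier := by
    intro R Q hQ
    rw [Finset.mem_filter] at hQ
    exact ⟨hF Q hQ.1, Cube.carrier_subset_of_halfOpen_subset hQ.2⟩
  have hbound := hmain F Cube.halfOpen (Cube.laminar_halfOpen hn fun Q hQ => hSd Q (hF Q hQ))
    (fun Q _ => Q.measurableSet_halfOpen) σ w (fun Q => ENNReal.ofReal Q.vol)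
    (ApqChar p q ω ^ (1 / q)) (ENNReal.ofReal (1 / η) * AinfChar v)
    (ENNReal.ofReal (1 / η) * AinfChar u) g hgm hgtop
    (fun Q _ => ⟨Q.ofReal_vol_ne_zero, ENNReal.ofReal_ne_top⟩)
    (fun Q _ => by rw [hσQ]; exact ⟨hv0 Q, hv1 Q⟩) (fun Q _ => by rw [hwQ]; exact ⟨hu0 Q, hu1 Q⟩)
    (fun R _ => hS.sum_vol_le hη (hsub R))
    (fun R _ => by
      simp_rw [hσQ]
      exact hS.sum_wMass_le hη (hsub R) (fun x => Real.rpow_nonneg (hω x) _) (hv0 R) (hv1 R))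
    (fun R _ => by
      simp_rw [hwQ]
      exact hS.sum_wMass_le hη (hsub R) (fun x => Real.rpow_nonneg (hω x) _) (hu0 R) (hu1 R))
    (fun Q _ => by
      rw [hσQ, hwQ]
      exact two_weight_le_ApqChar hω hpos hωm hp hq0 hA hscale Q)
  have hd : ∀ Q : Cube n, ∫⁻ y in Q.halfOpen, g y ∂σ = ∫⁻ y in Q.carrier, ENNReal.ofReal (f y) :=
    setLIntegral_div_withDensity hvm hvpos
  simp_rw [hd, hexp] at hbound
  refine (ENNReal.rpow_le_rpow (lintegral_sum_indicator_le hr0 hr2 hq0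
    (withDensity_absolutelyContinuous _ _) _) (by positivity)).trans (hbound.trans ?_)
  rw [wNorm]
  gcongr

/-- mixed `A_{pq}`–`A∞` estimate for the fractional square function
(`r = 2`, `1/q + 1/p' = α`), in the one-weight setting `L^p_{ω^p} → L^q_{ω^q}`. -/
theorem stmt13 (n : ℕ) (hn : 1 ≤ n) (p q α η : ℝ)
    (hα : 0 < α) (hα1 : α < 1) (hp : 1 < p) (hpq : p ≤ q)
    (hscale : 1 / q + (1 - 1 / p) = α) (hη : 0 < η) (hη1 : η ≤ 1) :
    ∃ C : ℝ, 0 < C ∧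
      ∀ S : Set (Cube n), (∀ Q ∈ S, Q.IsDyadic) → IsSparse η S →
      ∀ ω : (Fin n → ℝ) → ℝ, IsWeight ω → ApqChar p q ω < ∞ →
      ∀ f : (Fin n → ℝ) → ℝ, Measurable f → wNorm p (fun x => ω x ^ p) f < ∞ →
        eNorm q (fun x => ω x ^ q) (sparseOp S 2 α f) ≤
          ENNReal.ofReal C * ApqChar p q ω ^ (1 / q) *
            (AinfChar (fun x => ω x ^ (-(p / (p - 1)))) ^ (1 / q) +
              AinfChar (fun x => ω x ^ q) ^ max (1 / 2 - 1 / p) 0) *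
            wNorm p (fun x => ω x ^ p) f := by
  have hq0 : 0 < q := by linarith
  obtain ⟨C, hC, hmain⟩ := exists_eNorm_sparseOp_le hn hα1 hp hpq hscale hη
  set e := max (1 / 2 - 1 / p) 0 with he
  have he0 : 0 ≤ e := le_max_right _ _
  have hq1 : 0 ≤ 1 / q := by positivity
  set L := ENNReal.ofReal (1 / η)
  have hD : C * (L ^ (1 / q) + L ^ e) ≠ ∞ :=
    ENNReal.mul_ne_top hC (ENNReal.add_ne_top.2
      ⟨ENNReal.rpow_ne_top_of_nonneg hq1 ENNReal.ofReal_ne_top,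
        ENNReal.rpow_ne_top_of_nonneg he0 ENNReal.ofReal_ne_top⟩)
  refine ⟨(C * (L ^ (1 / q) + L ^ e)).toReal + 1, by positivity, ?_⟩
  intro S hSd hS ω hω hA f hf hfin
  have hωm : AEMeasurable ω := hω.1.aestronglyMeasurable.aemeasurable
  by_cases hz : ∀ᵐ x, ω x = 0
  · have h0 : eNorm q (fun x => ω x ^ q) (sparseOp S 2 α f) = 0 := by
      have : ∀ᵐ x, sparseOp S 2 α f x ^ q * ENNReal.ofReal (ω x ^ q) = 0 := by
        filter_upwards [hz] with x hx
        simp [hx, Real.zero_rpow hq0.ne']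
      rw [eNorm, lintegral_congr_ae this]
      simp [hq0]
    rw [h0]
    exact zero_le
  have hpos := ae_pos_of_ApqChar_lt_top hω.2 hωm hp hq0 hA hz
  refine (hmain S hSd hS ω hω.2 hωm hpos hA f hf hfin).trans ?_
  have hle : C * (L ^ (1 / q) + L ^ e) ≤
      ENNReal.ofReal ((C * (L ^ (1 / q) + L ^ e)).toReal + 1) := by
    conv_lhs => rw [← ENNReal.ofReal_toReal hD]
    exact ENNReal.ofReal_le_ofReal (by linarith)
  refine le_trans ?_ (mul_le_mul_left (mul_le_mul_left (mul_le_mul_left hle _) _) _)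
  rw [ENNReal.mul_rpow_of_nonneg _ _ hq1, ENNReal.mul_rpow_of_nonneg _ _ he0]
  set A' := AinfChar (fun x => ω x ^ (-(p / (p - 1)))) ^ (1 / q)
  set B' := AinfChar (fun x => ω x ^ q) ^ e
  have hAB : L ^ (1 / q) * A' + L ^ e * B' ≤ (L ^ (1 / q) + L ^ e) * (A' + B') := by
    rw [mul_add]
    gcongr
    exacts [le_self_add, le_add_self]
  calc _ ≤ C * ApqChar p q ω ^ (1 / q) * ((L ^ (1 / q) + L ^ e) * (A' + B')) *
        wNorm p (fun x => ω x ^ p) f := by gcongr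
    _ = _ := by ring
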